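/- arXiv:1404.3182 — 12 statements merged into one kernel-verified Lean document; each statement's English description precedes it below -/
import Mathlib

section
/- Let (S, L, H) be an SLH triple on (h, K) with generator K₀ := -(1/2)L*L - iH. For every ω ∈ ℝ such that iω·I - K₀ is invertible in the bounded operators on h, the characteristic operator T(iω) := S - L∘(iω·I - K₀)⁻¹∘L*∘S is unitary on K: T(iω)*∘T(iω) = I and T(iω)∘T(iω)* = I. -/
open ContinuousLinearMap

/-- If `A + A† = L† L` and `R` is the inverse of `A`, then `1 - L R L†` is unitary. -/
theorem one_sub_comp_inverse_comp_adjoint_mem_unitary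
    {h K : Type*} [NormedAddCommGroup h] [InnerProductSpace ℂ h] [CompleteSpace h]
    [NormedAddCommGroup K] [InnerProductSpace ℂ K] [CompleteSpace K]
    (L : h →L[ℂ] K) (A R : h →L[ℂ] h) (hAR : A * R = 1) (hRA : R * A = 1)
    (hA : A + star A = adjoint L ∘L L) :
    1 - L ∘L R ∘L adjoint L ∈ unitary (K →L[ℂ] K) := by
  have hAR' : star R * star A = 1 := by rw [← star_mul, hAR, star_one]
  have hRA' : star A * star R = 1 := by rw [← star_mul, hRA, star_one]
  have left : star R * (adjoint L ∘L L) * R = star R + R := by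
    rw [← hA, mul_add, add_mul, mul_assoc, hAR, hAR', mul_one, one_mul]
  have right : R * (adjoint L ∘L L) * star R = star R + R := by
    rw [← hA, mul_add, add_mul, mul_assoc R (star A), hRA, hRA', mul_one, one_mul]
  have hstar : star (1 - L ∘L R ∘L adjoint L) = 1 - L ∘L star R ∘L adjoint L := by
    simp [star_eq_adjoint, adjoint_comp, comp_assoc]
  have expand (P Q : h →L[ℂ] h) (hPQ : P * (adjoint L ∘L L) * Q = P + Q) :
      (1 - L ∘L P ∘L adjoint L) * (1 - L ∘L Q ∘L adjoint L) = 1 := by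
    have key : (L ∘L P ∘L adjoint L) * (L ∘L Q ∘L adjoint L)
        = L ∘L P ∘L adjoint L + L ∘L Q ∘L adjoint L := by
      calc _ = L ∘L (P * (adjoint L ∘L L) * Q) ∘L adjoint L := rfl
        _ = _ := by rw [hPQ, add_comp, comp_add]
    rw [sub_mul, mul_sub, mul_sub, key]
    simp
  rw [Unitary.mem_iff, hstar]
  exact ⟨expand _ _ left, expand _ _ (right.trans (add_comm _ _))⟩

/-- For an SLH triple `(S, L, H)` with generator `K₀ = -(1/2)L*L - iH`,
for every real `ω` such that `iω•I - K₀` is invertible, the characteristic operator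
`T(iω) = S - L (iω•I - K₀)⁻¹ L* S` is unitary. -/
theorem characteristic_operator_unitary_on_imaginary_axis
    {h K : Type*} [NormedAddCommGroup h] [InnerProductSpace ℂ h] [CompleteSpace h]
    [NormedAddCommGroup K] [InnerProductSpace ℂ K] [CompleteSpace K]
    (S : K →L[ℂ] K) (L : h →L[ℂ] K) (H : h →L[ℂ] h)
    (hS : adjoint S * S = 1 ∧ S * adjoint S = 1)
    (hH : IsSelfAdjoint H)
    (K₀ : h →L[ℂ] h)
    (hK₀ : K₀ = -((1/2 : ℂ) • (adjoint L ∘L L)) - Complex.I • H)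
    (ω : ℝ)
    (hinv : IsUnit ((Complex.I * ω) • (1 : h →L[ℂ] h) - K₀))
    (T : K →L[ℂ] K)
    (hT : T = S - L ∘L Ring.inverse ((Complex.I * ω) • (1 : h →L[ℂ] h) - K₀)
        ∘L adjoint L ∘L S) :
    adjoint T * T = 1 ∧ T * adjoint T = 1 := by
  have hA : ((Complex.I * ω) • (1 : h →L[ℂ] h) - K₀)
      + star ((Complex.I * ω) • (1 : h →L[ℂ] h) - K₀) = adjoint L ∘L L := by
    have hLL : star (adjoint L ∘L L) = adjoint L ∘L L := by
      simp [star_eq_adjoint, adjoint_comp]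
    rw [hK₀]
    simp only [star_sub, star_neg, star_smul, star_one, hLL, hH.star_eq, star_mul',
      Complex.star_def, Complex.conj_I, Complex.conj_ofReal, map_div₀, map_one, map_ofNat]
    module
  have hV := one_sub_comp_inverse_comp_adjoint_mem_unitary L _ _
    (Ring.mul_inverse_cancel _ hinv) (Ring.inverse_mul_cancel _ hinv) hA
  have hTV : T = (1 - L ∘L Ring.inverse ((Complex.I * ω) • (1 : h →L[ℂ] h) - K₀)
      ∘L adjoint L) * S := by
    rw [hT, sub_mul, one_mul]
    rfl
  have hT' : T ∈ unitary (K →L[ℂ] K) := hTV ▸ mul_mem hV (Unitary.mem_iff.2 hS)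
  exact Unitary.mem_iff.1 hT'
end

section
/- All-pass representation. Let (S, L, H) be an SLH triple on (h, K) with generator K₀ := -(1/2)L*L - iH, and let s ∈ ℂ be such that s·I + iH is invertible on h. Set Σ(s) := L∘(s·I + iH)⁻¹∘L*, a bounded operator on K, and assume that I + (1/2)Σ(s) is invertible on K. Then s·I - K₀ is invertible on h, and the characteristic operator satisfies T(s) = (I - (1/2)Σ(s))∘(I + (1/2)Σ(s))⁻¹∘S; moreover (I - (1/2)Σ(s)) commutes with (I + (1/2)Σ(s))⁻¹. -/
open ContinuousLinearMap

section Woodbury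

variable {𝕜 E F : Type*} [NontriviallyNormedField 𝕜] [NormedAddCommGroup E] [NormedSpace 𝕜 E]
  [NormedAddCommGroup F] [NormedSpace 𝕜 F]
  {A R : E →L[𝕜] E} {L : E →L[𝕜] F} {M : F →L[𝕜] E} {G : F →L[𝕜] F} {c : 𝕜}

/-- The Woodbury formula gives a right inverse of `A + c M L`. -/
theorem woodbury_mul_right (hAR : A * R = 1)
    (hG : (1 + c • (L ∘L R ∘L M)) * G = 1) :
    (A + c • (M ∘L L)) * (R - c • (R ∘L M ∘L G ∘L L ∘L R)) = 1 := by
  ext x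
  have hA : ∀ y, A (R y) = y := fun y => DFunLike.congr_fun hAR y
  have hy : G (L (R x)) + c • L (R (M (G (L (R x))))) = L (R x) :=
    DFunLike.congr_fun hG (L (R x))
  have hM := congrArg M hy
  simp only [map_add, map_smul] at hM
  simp only [mul_apply_eq_comp, add_apply, sub_apply, smul_apply, comp_apply, map_sub, map_smul, hA,
    one_apply_eq_self]
  linear_combination (norm := module) (-c) • hM

/-- The Woodbury formula gives a left inverse of `A + c M L`. -/
theorem woodbury_mul_left (hRA : R * A = 1)
    (hG : G * (1 + c • (L ∘L R ∘L M)) = 1) :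
    (R - c • (R ∘L M ∘L G ∘L L ∘L R)) * (A + c • (M ∘L L)) = 1 := by
  ext x
  have hR : ∀ y, R (A y) = y := fun y => DFunLike.congr_fun hRA y
  have hy : G (L x + c • L (R (M (L x)))) = L x := DFunLike.congr_fun hG (L x)
  simp only [mul_apply_eq_comp, add_apply, sub_apply, smul_apply, comp_apply, map_add, map_smul, hR,
    one_apply_eq_self] at hy ⊢
  have hM := congrArg (fun y => R (M y)) hy
  simp only [map_add, map_smul] at hM
  linear_combination (norm := module) (-c) • hM

/-- Sandwiching the Woodbury inverse between `L` and `M`. -/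
theorem comp_woodbury_comp (hG : G * (1 + c • (L ∘L R ∘L M)) = 1) :
    L ∘L (R - c • (R ∘L M ∘L G ∘L L ∘L R)) ∘L M = (L ∘L R ∘L M) * G := by
  ext x
  have hy : G (x + c • L (R (M x))) = x := DFunLike.congr_fun hG x
  have hM := congrArg (fun y => L (R (M y))) hy
  simp only [map_add, map_smul] at hM
  simp only [mul_apply_eq_comp, sub_apply, smul_apply, comp_apply, map_sub, map_smul]
  linear_combination (norm := module) -hM

end Woodbury

/-- **All-pass representation.** For an SLH triple `(S, L, H)` with
generator `K₀ = -(1/2)L*L - iH`, if `s•I + iH` is invertible,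
`Sig(s) = L (s•I + iH)⁻¹ L*`, and `I + (1/2)Sig(s)` is invertible, then `s•I - K₀` is
invertible and `T(s) = (I - (1/2)Sig(s)) (I + (1/2)Sig(s))⁻¹ S`, with the two factors
commuting. -/
theorem characteristic_operator_all_pass
    {h K : Type*} [NormedAddCommGroup h] [InnerProductSpace ℂ h] [CompleteSpace h]
    [NormedAddCommGroup K] [InnerProductSpace ℂ K] [CompleteSpace K]
    (S : K →L[ℂ] K) (L : h →L[ℂ] K) (H : h →L[ℂ] h)
    (hS : adjoint S * S = 1 ∧ S * adjoint S = 1)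
    (hH : IsSelfAdjoint H)
    (K₀ : h →L[ℂ] h)
    (hK₀ : K₀ = -((1/2 : ℂ) • (adjoint L ∘L L)) - Complex.I • H)
    (s : ℂ)
    (hsH : IsUnit (s • (1 : h →L[ℂ] h) + Complex.I • H))
    (Sig : K →L[ℂ] K)
    (hSig : Sig = L ∘L Ring.inverse (s • (1 : h →L[ℂ] h) + Complex.I • H) ∘L adjoint L)
    (hG : IsUnit ((1 : K →L[ℂ] K) + (1/2 : ℂ) • Sig)) :
    IsUnit (s • (1 : h →L[ℂ] h) - K₀) ∧
      S - L ∘L Ring.inverse (s • (1 : h →L[ℂ] h) - K₀) ∘L adjoint L ∘L S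
        = ((1 : K →L[ℂ] K) - (1/2 : ℂ) • Sig) *
            Ring.inverse ((1 : K →L[ℂ] K) + (1/2 : ℂ) • Sig) * S ∧
      Commute ((1 : K →L[ℂ] K) - (1/2 : ℂ) • Sig)
        (Ring.inverse ((1 : K →L[ℂ] K) + (1/2 : ℂ) • Sig)) := by
  set A := s • (1 : h →L[ℂ] h) + Complex.I • H with hA
  set G := Ring.inverse ((1 : K →L[ℂ] K) + (1/2 : ℂ) • Sig) with hGdef
  have hGr : (1 + (1/2 : ℂ) • Sig) * G = 1 := Ring.mul_inverse_cancel _ hG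
  have hGl : G * (1 + (1/2 : ℂ) • Sig) = 1 := Ring.inverse_mul_cancel _ hG
  have hB : s • (1 : h →L[ℂ] h) - K₀ = A + (1/2 : ℂ) • (adjoint L ∘L L) := by
    rw [hK₀, hA]
    abel
  have hright := woodbury_mul_right (Ring.mul_inverse_cancel _ hsH) (hSig ▸ hGr)
  have hleft := woodbury_mul_left (Ring.inverse_mul_cancel _ hsH) (hSig ▸ hGl)
  have hsandwich := comp_woodbury_comp (hSig ▸ hGl)
  rw [← hSig] at hsandwich
  rw [hB]
  have hinv := Ring.inverse_unit ⟨_, _, hright, hleft⟩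
  refine ⟨⟨⟨_, _, hright, hleft⟩, rfl⟩, ?_, ?_⟩
  · have hT : (1 - (1/2 : ℂ) • Sig) * G = 1 - Sig * G := by
      trans (1 + (1/2 : ℂ) • Sig) * G - Sig * G
      swap
      · rw [hGr]
      rw [← sub_mul]
      congr 1
      module
    rw [hT, ← hsandwich, sub_mul, one_mul]
    exact congrArg (fun B => S - (L ∘L B ∘L adjoint L) * S) hinv
  · have hcomm : Commute ((1 : K →L[ℂ] K) - (1/2 : ℂ) • Sig) (1 + (1/2 : ℂ) • Sig) :=
      ((Commute.one_left _).sub_left ((Commute.one_right _).add_right (Commute.refl _)))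
    rw [hGdef, ← hG.unit_spec, Ring.inverse_unit]
    exact hcomm.units_inv_right (u := hG.unit)
end

section
/- QND form of the characteristic operator. Let h be a complex Hilbert space and let S, L, H be bounded operators on h with S unitary, H self-adjoint, and L∘H = H∘L. Let s ∈ ℂ be such that both s·I + (1/2)L*L + iH and s·I + (1/2)LL* + iH are invertible on h. Then the characteristic operator T(s) := S - L∘(s·I + (1/2)L*L + iH)⁻¹∘L*∘S satisfies T(s) = (s·I + (1/2)LL* + iH)⁻¹∘(s·I - (1/2)LL* + iH)∘S, and the two factors (s·I - (1/2)LL* + iH) and (s·I + (1/2)LL* + iH)⁻¹ commute. -/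
open ContinuousLinearMap

/-- An intertwiner of two invertible elements also intertwines their inverses. -/
theorem SemiconjBy.ringInverse_of_isUnit {R : Type*} [MonoidWithZero R] {x a b : R}
    (hx : SemiconjBy x a b) (ha : IsUnit a) (hb : IsUnit b) :
    SemiconjBy x (Ring.inverse a) (Ring.inverse b) := by
  obtain ⟨u, rfl⟩ := ha
  obtain ⟨v, rfl⟩ := hb
  simpa only [Ring.inverse_unit] using hx.units_inv_right

/-- **QND form of the characteristic operator.** If `S, L, H` are bounded
operators on `h`, `S` unitary, `H` self-adjoint, `L` commutes with `H`, and both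
`s•I + (1/2)L*L + iH` and `s•I + (1/2)LL* + iH` are invertible, then
`T(s) = (s•I + (1/2)LL* + iH)⁻¹ (s•I - (1/2)LL* + iH) S` and the two factors commute. -/
theorem characteristic_operator_qnd_form
    {h : Type*} [NormedAddCommGroup h] [InnerProductSpace ℂ h] [CompleteSpace h]
    (S L H : h →L[ℂ] h)
    (hS : adjoint S * S = 1 ∧ S * adjoint S = 1)
    (hH : IsSelfAdjoint H)
    (hLH : L ∘L H = H ∘L L)
    (s : ℂ)
    (h1 : IsUnit (s • (1 : h →L[ℂ] h) + (1/2 : ℂ) • (adjoint L ∘L L) + Complex.I • H))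
    (h2 : IsUnit (s • (1 : h →L[ℂ] h) + (1/2 : ℂ) • (L ∘L adjoint L) + Complex.I • H)) :
    S - L ∘L Ring.inverse
          (s • (1 : h →L[ℂ] h) + (1/2 : ℂ) • (adjoint L ∘L L) + Complex.I • H)
        ∘L adjoint L ∘L S
      = Ring.inverse (s • (1 : h →L[ℂ] h) + (1/2 : ℂ) • (L ∘L adjoint L) + Complex.I • H)
          * (s • (1 : h →L[ℂ] h) - (1/2 : ℂ) • (L ∘L adjoint L) + Complex.I • H) * S ∧
      Commute (s • (1 : h →L[ℂ] h) - (1/2 : ℂ) • (L ∘L adjoint L) + Complex.I • H)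
        (Ring.inverse
          (s • (1 : h →L[ℂ] h) + (1/2 : ℂ) • (L ∘L adjoint L) + Complex.I • H)) := by
  simp only [← ContinuousLinearMap.mul_def] at *
  have hHL : Commute H (adjoint L) := by
    simpa only [ContinuousLinearMap.star_eq_adjoint, hH.star_eq] using
      (show Commute H L from hLH.symm).star_star
  have hHLL : Commute H (L * adjoint L) := (show Commute H L from hLH.symm).mul_right hHL
  have hsemi : SemiconjBy L
      (s • (1 : h →L[ℂ] h) + (1/2 : ℂ) • (adjoint L * L) + Complex.I • H)
      (s • (1 : h →L[ℂ] h) + (1/2 : ℂ) • (L * adjoint L) + Complex.I • H) := by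
    simp only [SemiconjBy, mul_add, add_mul, mul_smul_comm, smul_mul_assoc, mul_one, one_mul,
      mul_assoc, hLH]
  have hinv := (hsemi.ringInverse_of_isUnit h1 h2).eq
  have hsub : s • (1 : h →L[ℂ] h) - (1/2 : ℂ) • (L * adjoint L) + Complex.I • H =
      s • (1 : h →L[ℂ] h) + (1/2 : ℂ) • (L * adjoint L) + Complex.I • H - L * adjoint L := by
    module
  have hcomm : Commute (L * adjoint L)
      (s • (1 : h →L[ℂ] h) + (1/2 : ℂ) • (L * adjoint L) + Complex.I • H) :=
    (((Commute.one_right _).smul_right s).add_right ((Commute.refl _).smul_right _)).add_right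
      (hHLL.symm.smul_right _)
  rw [hsub]
  refine ⟨?_, SemiconjBy.ringInverse_of_isUnit ((Commute.refl _).sub_left hcomm) h2 h2⟩
  rw [mul_sub, Ring.inverse_mul_cancel _ h2, sub_mul, one_mul, ← mul_assoc L, hinv]
  simp only [mul_assoc]
end

section
/- Stratonovich form of the characteristic operator. Let E_ll, E_l0, E00 be Stratonovich coefficients on (h, K) with derived SLH triple (S, L, H) and generator K₀ := -(1/2)L*L - iH. Let s ∈ ℂ be such that s·I + iE00 is invertible on h, the operator G(s) := I + (i/2)E_ll + (1/2)·E_l0∘(s·I + iE00)⁻¹∘E_0l is invertible on K, and s·I - K₀ is invertible on h. Then the characteristic operator T(s) := S - L∘(s·I - K₀)⁻¹∘L*∘S satisfies T(s) = (I - (i/2)E_ll - (1/2)·E_l0∘(s·I + iE00)⁻¹∘E_0l)∘G(s)⁻¹, and the numerator factor commutes with G(s)⁻¹. -/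
open ContinuousLinearMap

/-- For self-adjoint `a`, the operator `1 + (i/2) a` is invertible. -/
theorem IsSelfAdjoint.isUnit_one_add_I_div_two_smul {A : Type*} [CStarAlgebra A] {a : A}
    (ha : IsSelfAdjoint a) : IsUnit (1 + (Complex.I / 2) • a) := by
  have hmem : (2 * Complex.I) ∉ spectrum ℂ a := fun hm => by
    simpa using congrArg Complex.im (ha.mem_spectrum_eq_re hm)
  have hunit := spectrum.notMem_iff.mp hmem
  have hne : -(Complex.I / 2) ≠ 0 := by simp
  have key : 1 + (Complex.I / 2) • a =
      Units.mk0 _ hne • (algebraMap ℂ A (2 * Complex.I) - a) := by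
    rw [Units.smul_mk0, smul_sub, Algebra.algebraMap_eq_smul_one, smul_smul]
    have hI : -(Complex.I / 2) * (2 * Complex.I) = 1 := by
      linear_combination -Complex.I_mul_I
    rw [hI, one_smul, neg_smul, sub_neg_eq_add]
  rw [key]
  exact hunit.smul _

/-- If `a` is self-adjoint and `r` is a right inverse of `1 + (i/2) a`, then
`r + r* = 2 r* r`. -/
theorem add_star_eq_two_smul_star_mul {A : Type*} [Ring A] [StarRing A] [Algebra ℂ A]
    [StarModule ℂ A] {a r : A} (ha : IsSelfAdjoint a) (har : (1 + (Complex.I / 2) • a) * r = 1) :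
    r + star r = (2 : ℂ) • (star r * r) := by
  have hstar : star r * (1 - (Complex.I / 2) • a) = 1 := by
    simpa [ha.star_eq, neg_div, sub_eq_add_neg] using congrArg star har
  calc r + star r = star r * (1 - (Complex.I / 2) • a) * r
        + star r * ((1 + (Complex.I / 2) • a) * r) := by rw [hstar, har, one_mul, mul_one]
    _ = (2 : ℂ) • (star r * r) := by
      rw [two_smul]
      noncomm_ring

/-- The Woodbury identity, as a right-inverse statement. -/
theorem woodbury_right_inverse {h K : Type*} [NormedAddCommGroup h] [NormedSpace ℂ h]
    [NormedAddCommGroup K] [NormedSpace ℂ K] {A R : K →L[ℂ] K} {D Q N : h →L[ℂ] h}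
    {E : h →L[ℂ] K} {F : K →L[ℂ] h} (c : ℂ) (hAR : A * R = 1) (hQD : Q * D = 1)
    (hMN : (D + c • (F ∘L R ∘L E)) * N = 1) :
    (A + c • (E ∘L Q ∘L F)) * (R - c • (R ∘L E ∘L N ∘L F ∘L R)) = 1 := by
  ext x
  have hA (y : K) : A (R y) = y := DFunLike.congr_fun hAR y
  have hQ (y : h) : Q (D y) = y := DFunLike.congr_fun hQD y
  have hM : D (N (F (R x))) + c • F (R (E (N (F (R x))))) = F (R x) :=
    DFunLike.congr_fun hMN (F (R x))
  have hE := congrArg (fun y => E (Q y)) hM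
  simp only [map_add, map_smul, hQ] at hE
  simp only [mul_def, one_def, id_apply, add_apply, sub_apply, smul_apply, comp_apply, map_sub, map_smul, hA,
    ← hE]
  module

/-- The generator `-(1/2) L*L - iH` of the derived SLH triple equals `-iE00 - (1/2) E* R E`,
for any `R` with `R + R* = 2 R* R`, such as the inverse of `1 + (i/2) Ell`. -/
theorem generator_eq_of_stratonovich {h K : Type*} [NormedAddCommGroup h]
    [InnerProductSpace ℂ h] [CompleteSpace h] [NormedAddCommGroup K] [InnerProductSpace ℂ K]
    [CompleteSpace K] {R : K →L[ℂ] K} (E : h →L[ℂ] K) (E00 : h →L[ℂ] h)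
    (hR : R + adjoint R = (2 : ℂ) • (adjoint R * R)) :
    -((1/2 : ℂ) • (adjoint (Complex.I • (R ∘L E)) ∘L (Complex.I • (R ∘L E)))) -
        Complex.I • (E00 + (1/2 : ℂ) • ((2 * Complex.I)⁻¹ •
          ((adjoint E ∘L R ∘L E) - adjoint (adjoint E ∘L R ∘L E)))) =
      -(Complex.I • E00) - (1/2 : ℂ) • (adjoint E ∘L R ∘L E) := by
  ext x
  have hRx : R (E x) + adjoint R (E x) = (2 : ℂ) • adjoint R (R (E x)) :=
    DFunLike.congr_fun hR (E x)
  have hEx := congrArg (adjoint E) hRx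
  simp only [map_add, map_smul] at hEx
  simp only [map_smulₛₗ, adjoint_comp, adjoint_adjoint, add_apply, sub_apply, neg_apply,
    smul_apply, comp_apply, Complex.conj_I, RingHom.id_apply, smul_add, smul_smul]
  have hc : Complex.I * (1 / 2) * (2 * Complex.I)⁻¹ = 1 / 4 := by
    field_simp
    norm_num
  have hI : 1 / 2 * (Complex.I * -Complex.I) = 1 / 2 := by simp
  simp only [← mul_assoc, hc]
  rw [mul_assoc, hI]
  have hp : adjoint E (adjoint R (R (E x))) =
      (1/2 : ℂ) • (adjoint E (R (E x)) + adjoint E (adjoint R (E x))) := by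
    rw [hEx]
    module
  rw [hp]
  module

/-- **Stratonovich form of the characteristic operator.** For Stratonovich
coefficients `(E_ll, E_l0, E00)` with derived SLH triple `(S, L, H)` and generator
`K₀ = -(1/2)L*L - iH`, whenever `s•I + iE00`, `G(s) = I + (i/2)E_ll +
(1/2) E_l0 (s•I + iE00)⁻¹ E_0l` and `s•I - K₀` are invertible, the characteristic
operator satisfies `T(s) = (I - (i/2)E_ll - (1/2) E_l0 (s•I + iE00)⁻¹ E_0l) G(s)⁻¹`,
with the numerator commuting with `G(s)⁻¹`. -/
theorem characteristic_operator_stratonovich_form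
    {h K : Type*} [NormedAddCommGroup h] [InnerProductSpace ℂ h] [CompleteSpace h]
    [NormedAddCommGroup K] [InnerProductSpace ℂ K] [CompleteSpace K]
    (Ell : K →L[ℂ] K) (El0 : h →L[ℂ] K) (E00 : h →L[ℂ] h)
    (hEll : IsSelfAdjoint Ell) (hE00 : IsSelfAdjoint E00)
    (S : K →L[ℂ] K)
    (hS : S = ((1 : K →L[ℂ] K) - (Complex.I / 2) • Ell) *
        Ring.inverse ((1 : K →L[ℂ] K) + (Complex.I / 2) • Ell))
    (L : h →L[ℂ] K)
    (hL : L = Complex.I •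
        (Ring.inverse ((1 : K →L[ℂ] K) + (Complex.I / 2) • Ell) ∘L El0))
    (H : h →L[ℂ] h)
    (hH : H = E00 + (1/2 : ℂ) • ((2 * Complex.I)⁻¹ •
        ((adjoint El0 ∘L Ring.inverse ((1 : K →L[ℂ] K) + (Complex.I / 2) • Ell) ∘L El0) -
          adjoint (adjoint El0 ∘L
            Ring.inverse ((1 : K →L[ℂ] K) + (Complex.I / 2) • Ell) ∘L El0))))
    (K₀ : h →L[ℂ] h)
    (hK₀ : K₀ = -((1/2 : ℂ) • (adjoint L ∘L L)) - Complex.I • H)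
    (s : ℂ)
    (h1 : IsUnit (s • (1 : h →L[ℂ] h) + Complex.I • E00))
    (G : K →L[ℂ] K)
    (hG : G = (1 : K →L[ℂ] K) + (Complex.I / 2) • Ell +
        (1/2 : ℂ) • (El0 ∘L Ring.inverse (s • (1 : h →L[ℂ] h) + Complex.I • E00)
          ∘L adjoint El0))
    (hGinv : IsUnit G)
    (h2 : IsUnit (s • (1 : h →L[ℂ] h) - K₀)) :
    S - L ∘L Ring.inverse (s • (1 : h →L[ℂ] h) - K₀) ∘L adjoint L ∘L S
      = ((1 : K →L[ℂ] K) - (Complex.I / 2) • Ell -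
          (1/2 : ℂ) • (El0 ∘L Ring.inverse (s • (1 : h →L[ℂ] h) + Complex.I • E00)
            ∘L adjoint El0)) * Ring.inverse G ∧
      Commute ((1 : K →L[ℂ] K) - (Complex.I / 2) • Ell -
          (1/2 : ℂ) • (El0 ∘L Ring.inverse (s • (1 : h →L[ℂ] h) + Complex.I • E00)
            ∘L adjoint El0)) (Ring.inverse G) := by
  set A := (1 : K →L[ℂ] K) + (Complex.I / 2) • Ell with hA
  set R := Ring.inverse A
  set D := s • (1 : h →L[ℂ] h) + Complex.I • E00 with hD
  set Q := Ring.inverse D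
  have hAu : IsUnit A := hEll.isUnit_one_add_I_div_two_smul
  have hAR : A * R = 1 := Ring.mul_inverse_cancel A hAu
  have hRR : R + adjoint R = (2 : ℂ) • (adjoint R * R) := add_star_eq_two_smul_star_mul hEll hAR
  have hM : s • (1 : h →L[ℂ] h) - K₀ = D + (1/2 : ℂ) • (adjoint El0 ∘L R ∘L El0) := by
    rw [hK₀, hH, hL, generator_eq_of_stratonovich El0 E00 hRR, hD]
    abel
  set N := Ring.inverse (s • (1 : h →L[ℂ] h) - K₀)
  have hMN : (D + (1/2 : ℂ) • (adjoint El0 ∘L R ∘L El0)) * N = 1 :=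
    hM ▸ Ring.mul_inverse_cancel _ h2
  have hW := woodbury_right_inverse (1/2) hAR (Ring.inverse_mul_cancel D h1) hMN
  rw [← hG] at hW
  have hGi : Ring.inverse G = R - (1/2 : ℂ) • (R ∘L El0 ∘L N ∘L adjoint El0 ∘L R) :=
    calc Ring.inverse G = Ring.inverse G * (G * _) := by rw [hW, mul_one]
      _ = _ := Ring.inverse_mul_cancel_left G _ hGinv
  have hnum : (1 : K →L[ℂ] K) - (Complex.I / 2) • Ell -
      (1/2 : ℂ) • (El0 ∘L Q ∘L adjoint El0) = (2 : ℂ) • 1 - G := by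
    rw [hG, hA]
    module
  have hSR : S = (2 : ℂ) • R - 1 := by
    have hconj : (1 : K →L[ℂ] K) - (Complex.I / 2) • Ell = (2 : ℂ) • 1 - A := by
      rw [hA]
      module
    rw [hS, hconj, sub_mul, hAR, smul_mul_assoc, one_mul]
  have hRS : adjoint R * S = R := by
    rw [hSR, mul_sub, mul_smul_comm, ← hRR, mul_one, add_sub_cancel_right]
  rw [hnum]
  refine ⟨?_, ?_⟩
  · rw [sub_mul, Ring.mul_inverse_cancel G hGinv, smul_mul_assoc, one_mul, hGi]
    ext x
    have hRSx : adjoint R (S x) = R x := DFunLike.congr_fun hRS x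
    simp only [hL, map_smulₛₗ, adjoint_comp, sub_apply, smul_apply, comp_apply, hRSx,
      Complex.conj_I]
    simp only [hSR, sub_apply, smul_apply, smul_smul, RingHom.id_apply]
    rw [neg_mul, Complex.I_mul_I, neg_neg]
    module
  · have hcomm : Commute G (Ring.inverse G) := by
      rw [commute_iff_eq, Ring.mul_inverse_cancel G hGinv, Ring.inverse_mul_cancel G hGinv]
    exact ((Commute.one_left _).smul_left _).sub_left hcomm
end

section
/- Strong-coupling scattering limit. Let h and K be complex Hilbert spaces, F_ll a bounded self-adjoint operator on K, F_l0 : h → K a bounded operator with F_0l := (F_l0)*, and F00 an invertible bounded self-adjoint operator on h. For k > 0 consider the scaled Stratonovich coefficients E_ll := F_ll, E_l0(k) := k·F_l0, E00(k) := k²·F00, and the corresponding Stratonovich characteristic expression T_k(s) := (I - (i/2)F_ll - (k²/2)·F_l0∘(s·I + i k²F00)⁻¹∘F_0l)∘(I + (i/2)F_ll + (k²/2)·F_l0∘(s·I + i k²F00)⁻¹∘F_0l)⁻¹. Fix s ∈ ℂ with Re s > 0. Then s·I + i k²F00 is invertible for every k > 0, for all sufficiently large k the operator I + (i/2)F_ll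 + (k²/2)·F_l0∘(s·I + i k²F00)⁻¹∘F_0l is invertible on K, and T_k(s) converges in operator norm as k → ∞ to the unitary Ŝ := (I - (i/2)Ê)∘(I + (i/2)Ê)⁻¹, where Ê := F_ll - F_l0∘F00⁻¹∘F_0l is the Schur complement of the Stratonovich coefficients. -/
open ContinuousLinearMap Filter

/-- `s + i r a` is invertible for `a` self-adjoint, `r` real and `Re s ≠ 0`. -/
theorem IsSelfAdjoint.isUnit_smul_one_add_I_mul_smul {A : Type*} [CStarAlgebra A] {a : A}
    (ha : IsSelfAdjoint a) {s : ℂ} (hs : s.re ≠ 0) (r : ℝ) :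
    IsUnit (s • (1 : A) + (Complex.I * (r : ℂ)) • a) := by
  have hb : IsSelfAdjoint (r • a) := (IsSelfAdjoint.all r).smul ha
  have hz : IsUnit (algebraMap ℂ A (Complex.I * s) - r • a) := by
    by_contra hu
    have h_im := congrArg Complex.im (hb.mem_spectrum_eq_re (spectrum.mem_iff.2 hu))
    simp at h_im
    exact hs h_im
  have h_eq : s • (1 : A) + (Complex.I * (r : ℂ)) • a =
      (-Complex.I) • (algebraMap ℂ A (Complex.I * s) - r • a) := by
    rw [Algebra.algebraMap_eq_smul_one, ← Complex.coe_smul r a, smul_sub, smul_smul, smul_smul,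
      ← mul_assoc, neg_mul, Complex.I_mul_I]
    simp
  rw [h_eq]
  exact hz.smul (Units.mk0 (-Complex.I) (neg_ne_zero.2 Complex.I_ne_zero))

theorem Ring.inverse_smul_of_ne_zero {𝕜 A : Type*} [Field 𝕜] [Ring A] [Algebra 𝕜 A]
    {c : 𝕜} (hc : c ≠ 0) {a : A} (ha : IsUnit a) :
    Ring.inverse (c • a) = c⁻¹ • Ring.inverse a := by
  have hca : IsUnit (c • a) := ha.smul (Units.mk0 c hc)
  refine hca.mul_left_cancel ?_
  rw [Ring.mul_inverse_cancel _ hca, smul_mul_smul_comm, mul_inv_cancel₀ hc,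
    Ring.mul_inverse_cancel _ ha, one_smul]

/-- The Cayley transform of a self-adjoint element is unitary. -/
theorem IsSelfAdjoint.cayley_mem_unitary {A : Type*} [CStarAlgebra A] {a : A}
    (ha : IsSelfAdjoint a) :
    ((1 : A) - (Complex.I / 2) • a) * Ring.inverse ((1 : A) + (Complex.I / 2) • a) ∈
      unitary A := by
  have hB : IsUnit ((1 : A) + (Complex.I / 2) • a) := by
    have := ha.isUnit_smul_one_add_I_mul_smul (s := 1) (by simp) (1 / 2)
    simpa [div_eq_mul_inv] using this
  have h_star : star ((1 : A) + (Complex.I / 2) • a) = 1 - (Complex.I / 2) • a := by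
    simp [ha.star_eq, neg_div, sub_eq_add_neg]
  set b := (1 : A) + (Complex.I / 2) • a with hb
  have h_comm : star b * b = b * star b := by
    rw [h_star, hb, sub_mul, mul_sub, mul_add, add_mul]
    simp only [one_mul, mul_one, mul_add, add_mul]
  have hBs : IsUnit (star b) := hB.star
  rw [← h_star, Unitary.mem_iff]
  rw [star_mul, star_star, ← Ring.inverse_star]
  constructor
  · calc Ring.inverse (star b) * b * (star b * Ring.inverse b)
        = Ring.inverse (star b) * (b * star b) * Ring.inverse b := by noncomm_ring
      _ = (Ring.inverse (star b) * star b) * (b * Ring.inverse b) := by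
          rw [← h_comm]; noncomm_ring
      _ = 1 := by rw [Ring.inverse_mul_cancel _ hBs, Ring.mul_inverse_cancel _ hB, one_mul]
  · have h_inv : Ring.inverse b * Ring.inverse (star b) =
        Ring.inverse (star b) * Ring.inverse b :=
      (Commute.ringInverse_ringInverse (show Commute b (star b) from h_comm.symm)).eq
    calc star b * Ring.inverse b * (Ring.inverse (star b) * b)
        = star b * (Ring.inverse b * Ring.inverse (star b)) * b := by noncomm_ring
      _ = (star b * Ring.inverse (star b)) * (Ring.inverse b * b) := by
          rw [h_inv]; noncomm_ring
      _ = 1 := by rw [Ring.mul_inverse_cancel _ hBs, Ring.inverse_mul_cancel _ hB, one_mul]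

/-- Norm convergence of the rescaled resolvent `k² (s + i k² a)⁻¹` to `-i a⁻¹`. -/
theorem IsSelfAdjoint.tendsto_sq_smul_inverse {A : Type*} [CStarAlgebra A] {a : A}
    (ha : IsSelfAdjoint a) (hu : IsUnit a) {s : ℂ} (hs : s.re ≠ 0) :
    Tendsto (fun k : ℝ => ((k : ℂ) ^ 2) •
        Ring.inverse (s • (1 : A) + (Complex.I * (k : ℂ) ^ 2) • a))
      atTop (nhds ((-Complex.I) • Ring.inverse a)) := by
  have hIa : IsUnit (Complex.I • a) := hu.smul (Units.mk0 Complex.I Complex.I_ne_zero)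
  have h_scalar : Tendsto (fun k : ℝ => ((k : ℂ) ^ 2)⁻¹ * s) atTop (nhds 0) := by
    have h_real : Tendsto (fun k : ℝ => (k ^ 2)⁻¹) atTop (nhds 0) :=
      (tendsto_pow_atTop two_ne_zero).inv_tendsto_atTop
    have h_cast := (Complex.continuous_ofReal.tendsto 0).comp h_real
    simpa [Function.comp_def] using h_cast.mul_const s
  have h_arg : Tendsto (fun k : ℝ => (((k : ℂ) ^ 2)⁻¹ * s) • (1 : A) + Complex.I • a)
      atTop (nhds (Complex.I • a)) := by
    simpa using (h_scalar.smul_const (1 : A)).add_const (Complex.I • a)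
  obtain ⟨u, hu_eq⟩ := hIa
  have h_inv := (hu_eq ▸ NormedRing.inverse_continuousAt u : ContinuousAt Ring.inverse
    (Complex.I • a)).tendsto.comp h_arg
  rw [Ring.inverse_smul_of_ne_zero Complex.I_ne_zero hu, Complex.inv_I] at h_inv
  refine h_inv.congr' ?_
  filter_upwards [eventually_gt_atTop 0] with k hk
  have hk2 : ((k : ℂ) ^ 2) ≠ 0 := pow_ne_zero 2 (Complex.ofReal_ne_zero.2 hk.ne')
  have h_unit : IsUnit (s • (1 : A) + (Complex.I * (k : ℂ) ^ 2) • a) := by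
    rw [← Complex.ofReal_pow]
    exact ha.isUnit_smul_one_add_I_mul_smul hs (k ^ 2)
  have h_eq : (((k : ℂ) ^ 2)⁻¹ * s) • (1 : A) + Complex.I • a =
      ((k : ℂ) ^ 2)⁻¹ • (s • (1 : A) + (Complex.I * (k : ℂ) ^ 2) • a) := by
    rw [smul_add, smul_smul, smul_smul, mul_comm Complex.I, inv_mul_cancel_left₀ hk2]
  rw [Function.comp_apply, h_eq, Ring.inverse_smul_of_ne_zero (inv_ne_zero hk2) h_unit, inv_inv]

/-- **Strong-coupling scattering limit.** For scaled Stratonovich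
coefficients `E_ll = F_ll`, `E_l0(k) = k F_l0`, `E00(k) = k² F00` with `F00` invertible
self-adjoint, and `Re s > 0`: `s•I + i k² F00` is invertible for every `k > 0`;
for all sufficiently large `k` the denominator
`I + (i/2)F_ll + (k²/2) F_l0 (s•I + i k² F00)⁻¹ F_0l` is invertible; and the
Stratonovich characteristic expression `T_k(s)` converges in operator norm to the
unitary `Ŝ = (I - (i/2)Ê)(I + (i/2)Ê)⁻¹` with Schur complement
`Ê = F_ll - F_l0 F00⁻¹ F_0l`. -/
theorem strong_coupling_scattering_limit
    {h K : Type*} [NormedAddCommGroup h] [InnerProductSpace ℂ h] [CompleteSpace h]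
    [NormedAddCommGroup K] [InnerProductSpace ℂ K] [CompleteSpace K]
    (Fll : K →L[ℂ] K) (Fl0 : h →L[ℂ] K) (F00 : h →L[ℂ] h)
    (hFll : IsSelfAdjoint Fll) (hF00 : IsSelfAdjoint F00) (hF00inv : IsUnit F00)
    (s : ℂ) (hs : 0 < s.re)
    (Ehat : K →L[ℂ] K)
    (hEhat : Ehat = Fll - Fl0 ∘L Ring.inverse F00 ∘L adjoint Fl0)
    (Shat : K →L[ℂ] K)
    (hShat : Shat = ((1 : K →L[ℂ] K) - (Complex.I / 2) • Ehat) *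
        Ring.inverse ((1 : K →L[ℂ] K) + (Complex.I / 2) • Ehat)) :
    (∀ k : ℝ, 0 < k →
        IsUnit (s • (1 : h →L[ℂ] h) + (Complex.I * (k : ℂ) ^ 2) • F00)) ∧
      (∀ᶠ k : ℝ in atTop,
        IsUnit ((1 : K →L[ℂ] K) + (Complex.I / 2) • Fll +
          (((k : ℂ) ^ 2) / 2) • (Fl0 ∘L
            Ring.inverse (s • (1 : h →L[ℂ] h) + (Complex.I * (k : ℂ) ^ 2) • F00)
            ∘L adjoint Fl0))) ∧
      Tendsto (fun k : ℝ =>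
          ((1 : K →L[ℂ] K) - (Complex.I / 2) • Fll -
            (((k : ℂ) ^ 2) / 2) • (Fl0 ∘L
              Ring.inverse (s • (1 : h →L[ℂ] h) + (Complex.I * (k : ℂ) ^ 2) • F00)
              ∘L adjoint Fl0)) *
          Ring.inverse ((1 : K →L[ℂ] K) + (Complex.I / 2) • Fll +
            (((k : ℂ) ^ 2) / 2) • (Fl0 ∘L
              Ring.inverse (s • (1 : h →L[ℂ] h) + (Complex.I * (k : ℂ) ^ 2) • F00)
              ∘L adjoint Fl0)))
        atTop (nhds Shat) ∧
      (adjoint Shat * Shat = 1 ∧ Shat * adjoint Shat = 1) := by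
  have hs' : s.re ≠ 0 := hs.ne'
  have hE : IsSelfAdjoint Ehat := by
    have h_inv : IsSelfAdjoint (Ring.inverse F00) := by
      rw [IsSelfAdjoint, ← Ring.inverse_star, hF00.star_eq]
    rw [hEhat]
    exact hFll.sub (h_inv.conj_adjoint Fl0)
  have hB : IsUnit ((1 : K →L[ℂ] K) + (Complex.I / 2) • Ehat) := by
    have := hE.isUnit_smul_one_add_I_mul_smul (s := 1) (by simp) (1 / 2)
    simpa [div_eq_mul_inv] using this
  have h_coupling : Tendsto (fun k : ℝ => (((k : ℂ) ^ 2) / 2) • (Fl0 ∘L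
      Ring.inverse (s • (1 : h →L[ℂ] h) + (Complex.I * (k : ℂ) ^ 2) • F00) ∘L adjoint Fl0))
      atTop (nhds (-((Complex.I / 2) • (Fl0 ∘L Ring.inverse F00 ∘L adjoint Fl0)))) := by
    have h_cont : Continuous fun X : h →L[ℂ] h =>
        (2⁻¹ : ℂ) • (Fl0 ∘L X ∘L adjoint Fl0) := by fun_prop
    have h_lim := (h_cont.tendsto _).comp (hF00.tendsto_sq_smul_inverse hF00inv hs')
    convert h_lim using 2
    · simp [smul_smul, div_eq_inv_mul]
    · simp [smul_smul, div_eq_inv_mul]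
  have h_den := h_coupling.const_add ((1 : K →L[ℂ] K) + (Complex.I / 2) • Fll)
  have h_num := h_coupling.const_sub ((1 : K →L[ℂ] K) - (Complex.I / 2) • Fll)
  have h_den_eq : (1 : K →L[ℂ] K) + (Complex.I / 2) • Fll +
      -((Complex.I / 2) • (Fl0 ∘L Ring.inverse F00 ∘L adjoint Fl0)) =
      1 + (Complex.I / 2) • Ehat := by
    rw [hEhat, smul_sub]; abel
  have h_num_eq : (1 : K →L[ℂ] K) - (Complex.I / 2) • Fll -
      -((Complex.I / 2) • (Fl0 ∘L Ring.inverse F00 ∘L adjoint Fl0)) =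
      1 - (Complex.I / 2) • Ehat := by
    rw [hEhat, smul_sub]; abel
  rw [h_den_eq] at h_den
  rw [h_num_eq] at h_num
  refine ⟨fun k _ => ?_, ?_, ?_, ?_⟩
  · rw [← Complex.ofReal_pow]
    exact hF00.isUnit_smul_one_add_I_mul_smul hs' (k ^ 2)
  · exact h_den.eventually (Units.isOpen.mem_nhds hB)
  · rw [hShat]
    obtain ⟨u, hu⟩ := hB
    exact h_num.mul ((hu ▸ NormedRing.inverse_continuousAt u : ContinuousAt Ring.inverse
      ((1 : K →L[ℂ] K) + (Complex.I / 2) • Ehat)).tendsto.comp h_den)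
  · rw [hShat]
    exact Unitary.mem_iff.1 hE.cayley_mem_unitary
end

section
/- Invariance of the characteristic operator. Let (S, L, H) be an SLH triple on (h, K) with generator K₀ := -(1/2)L*L - iH, and let V be a unitary bounded operator on h. Then (S, L∘V, V*∘H∘V) is again an SLH triple, and for every s ∈ ℂ such that s·I - K₀ is invertible, the operator s·I - (-(1/2)(L∘V)*(L∘V) - i·V*HV) = s·I - V*K₀V is also invertible and the characteristic operators coincide: S - (L∘V)∘(s·I - V*K₀V)⁻¹∘(L∘V)*∘S = S - L∘(s·I - K₀)⁻¹∘L*∘S. -/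
open ContinuousLinearMap

/-- The ring inverse commutes with conjugation by an invertible element. -/
theorem Ring.inverse_conj {R : Type*} [MonoidWithZero R] {v w : R}
    (hwv : w * v = 1) (hvw : v * w = 1) (a : R) :
    Ring.inverse (w * a * v) = w * Ring.inverse a * v := by
  let u : Rˣ := ⟨v, w, hvw, hwv⟩
  by_cases ha : IsUnit a
  · obtain ⟨b, rfl⟩ := ha
    rw [show w * (b : R) * v = ((u⁻¹ * b * u : Rˣ) : R) from rfl, Ring.inverse_unit,
      Ring.inverse_unit, show w * ((b⁻¹ : Rˣ) : R) * v = ((u⁻¹ * b⁻¹ * u : Rˣ) : R) from rfl]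
    simp [mul_assoc]
  · have hwav : ¬ IsUnit (w * a * v) := by
      rwa [show w * a * v = ((u⁻¹ : Rˣ) : R) * a * (u : R) from rfl,
        Units.isUnit_mul_units, Units.isUnit_units_mul]
    rw [Ring.inverse_non_unit _ ha, Ring.inverse_non_unit _ hwav, mul_zero, zero_mul]

/-- **Invariance of the characteristic operator.** For an SLH triple
`(S, L, H)` with generator `K₀` and a unitary `V` on the plant space, the triple
`(S, L V, V* H V)` is again an SLH triple with generator `V* K₀ V`, and its
characteristic operator coincides with that of `(S, L, H)`. -/
theorem characteristic_operator_invariance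
    {h K : Type*} [NormedAddCommGroup h] [InnerProductSpace ℂ h] [CompleteSpace h]
    [NormedAddCommGroup K] [InnerProductSpace ℂ K] [CompleteSpace K]
    (S : K →L[ℂ] K) (L : h →L[ℂ] K) (H : h →L[ℂ] h)
    (hS : adjoint S * S = 1 ∧ S * adjoint S = 1)
    (hH : IsSelfAdjoint H)
    (V : h →L[ℂ] h)
    (hV : adjoint V * V = 1 ∧ V * adjoint V = 1)
    (K₀ : h →L[ℂ] h)
    (hK₀ : K₀ = -((1/2 : ℂ) • (adjoint L ∘L L)) - Complex.I • H)
    (s : ℂ) (hs : IsUnit (s • (1 : h →L[ℂ] h) - K₀)) :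
    IsSelfAdjoint (adjoint V ∘L H ∘L V) ∧
      -((1/2 : ℂ) • (adjoint (L ∘L V) ∘L (L ∘L V))) -
          Complex.I • (adjoint V ∘L H ∘L V)
        = adjoint V ∘L K₀ ∘L V ∧
      IsUnit (s • (1 : h →L[ℂ] h) - adjoint V ∘L K₀ ∘L V) ∧
      S - (L ∘L V) ∘L Ring.inverse (s • (1 : h →L[ℂ] h) - adjoint V ∘L K₀ ∘L V)
          ∘L adjoint (L ∘L V) ∘L S
        = S - L ∘L Ring.inverse (s • (1 : h →L[ℂ] h) - K₀) ∘L adjoint L ∘L S := by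
  have hconj : s • (1 : h →L[ℂ] h) - adjoint V ∘L K₀ ∘L V
      = adjoint V * (s • (1 : h →L[ℂ] h) - K₀) * V := by
    rw [mul_sub, sub_mul, mul_smul_comm, mul_one, smul_mul_assoc, hV.1]
    rfl
  have hVV (x : h) : V (adjoint V x) = x := DFunLike.congr_fun hV.2 x
  refine ⟨hH.adjoint_conj V, ?_, ?_, ?_⟩
  · subst hK₀
    ext x
    simp [adjoint_comp]
  · rw [hconj]
    exact ((isUnit_iff_exists.2 ⟨V, hV⟩).mul hs).mul (isUnit_iff_exists.2 ⟨adjoint V, hV.symm⟩)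
  · rw [hconj, Ring.inverse_conj hV.1 hV.2]
    ext x
    simp [adjoint_comp, hVV]
end

section
/- Scaled resolvent limit (Lemma on singularly scaled block operators). Let E and F be complex Hilbert spaces and let M11 : E → E, M12 : F → E, M21 : E → F, M22 : F → F be bounded operators with M22 invertible. For each k > 0 let M(k) be the block operator on E ⊕ F given by M(k) = [[M11, k·M12 + R12(k)], [k·M21 + R21(k), k²·M22 + R22(k)]], where R12(k) : F → E, R21(k) : E → F, R22(k) : F → F are bounded operators with ‖R12(k)‖/k → 0, ‖R21(k)‖/k → 0 and ‖R22(k)‖/k → 0 as k → ∞. Let s ∈ ℂ be such that s·I + M̂11 is invertible on E, where M̂11 := M11 - M12∘M22⁻¹∘M21. Then for all sufficiently large k the operator s·I + M(k) is invertible on E ⊕ F, and with D(k) := [[I_E, 0], [0, k·I_F]], the scaled inverse D(k)∘(s·I + M(k))⁻¹∘D(k) converges in operator norm as k → ∞ to the block operator [[(s·I + M̂11)⁻¹, -(s·I + M̂11)⁻¹∘M12∘M22⁻¹], [-M22⁻¹∘M21∘(s·I + M̂11)⁻¹, M22⁻¹ + M22⁻¹∘M21∘(s·I + M̂11)⁻¹∘M12∘M22⁻¹]].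 -/
open ContinuousLinearMap Filter

/-- The block operator `[[A, B], [C, D]]` on the Hilbert-space direct sum `E ⊕ F`,
acting as `(x, y) ↦ (A x + B y, C x + D y)`. -/
noncomputable def blockOp {E F : Type*}
    [NormedAddCommGroup E] [InnerProductSpace ℂ E]
    [NormedAddCommGroup F] [InnerProductSpace ℂ F]
    (A : E →L[ℂ] E) (B : F →L[ℂ] E) (C : E →L[ℂ] F) (D : F →L[ℂ] F) :
    WithLp 2 (E × F) →L[ℂ] WithLp 2 (E × F) :=
  ((WithLp.prodContinuousLinearEquiv 2 ℂ E F).symm.toContinuousLinearMap) ∘L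
    ((A.coprod B).prod (C.coprod D)) ∘L
    (WithLp.prodContinuousLinearEquiv 2 ℂ E F).toContinuousLinearMap

section BlockOp

variable {E F : Type*} [NormedAddCommGroup E] [InnerProductSpace ℂ E]
  [NormedAddCommGroup F] [InnerProductSpace ℂ F]

theorem blockOp_mul (A A' : E →L[ℂ] E) (B B' : F →L[ℂ] E) (C C' : E →L[ℂ] F)
    (D D' : F →L[ℂ] F) :
    blockOp A B C D * blockOp A' B' C' D' =
      blockOp (A ∘L A' + B ∘L C') (A ∘L B' + B ∘L D')
        (C ∘L A' + D ∘L C') (C ∘L B' + D ∘L D') := by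
  ext x
  simp [blockOp]

theorem blockOp_one : blockOp (1 : E →L[ℂ] E) 0 0 (1 : F →L[ℂ] F) = 1 := by
  refine ContinuousLinearMap.ext fun x => WithLp.ofLp_injective 2 (Prod.ext ?_ ?_) <;>
    simp [blockOp]

theorem smul_one_add_blockOp (s : ℂ) (A : E →L[ℂ] E) (B : F →L[ℂ] E) (C : E →L[ℂ] F)
    (D : F →L[ℂ] F) :
    s • (1 : WithLp 2 (E × F) →L[ℂ] WithLp 2 (E × F)) + blockOp A B C D =
      blockOp (s • 1 + A) B C (s • 1 + D) := by
  refine ContinuousLinearMap.ext fun x => WithLp.ofLp_injective 2 (Prod.ext ?_ ?_) <;>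
    simp [blockOp, add_assoc, add_left_comm]

theorem ContinuousLinearMap.tendsto_comp_comp {E₁ E₂ E₃ E₄ : Type*}
    [NormedAddCommGroup E₁] [NormedSpace ℂ E₁] [NormedAddCommGroup E₂] [NormedSpace ℂ E₂]
    [NormedAddCommGroup E₃] [NormedSpace ℂ E₃] [NormedAddCommGroup E₄] [NormedSpace ℂ E₄]
    {ι : Type*} {l : Filter ι} {f : ι → E₂ →L[ℂ] E₃} {f₀ : E₂ →L[ℂ] E₃}
    (hf : Tendsto f l (nhds f₀)) (P : E₃ →L[ℂ] E₄) (Q : E₁ →L[ℂ] E₂) :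
    Tendsto (fun i => P ∘L f i ∘L Q) l (nhds (P ∘L f₀ ∘L Q)) :=
  ((continuous_id.clm_comp_const Q).const_clm_comp P).tendsto f₀ |>.comp hf

theorem blockOp_eq_add (A : E →L[ℂ] E) (B : F →L[ℂ] E) (C : E →L[ℂ] F) (D : F →L[ℂ] F) :
    blockOp A B C D =
      ((WithLp.prodContinuousLinearEquiv 2 ℂ E F).symm.toContinuousLinearMap ∘L inl ℂ E F) ∘L
          A ∘L WithLp.fstL 2 ℂ E F +
        ((WithLp.prodContinuousLinearEquiv 2 ℂ E F).symm.toContinuousLinearMap ∘L inl ℂ E F) ∘L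
          B ∘L WithLp.sndL 2 ℂ E F +
        (((WithLp.prodContinuousLinearEquiv 2 ℂ E F).symm.toContinuousLinearMap ∘L inr ℂ E F) ∘L
          C ∘L WithLp.fstL 2 ℂ E F +
        ((WithLp.prodContinuousLinearEquiv 2 ℂ E F).symm.toContinuousLinearMap ∘L inr ℂ E F) ∘L
          D ∘L WithLp.sndL 2 ℂ E F) := by
  refine ContinuousLinearMap.ext fun x => WithLp.ofLp_injective 2 (Prod.ext ?_ ?_) <;>
    simp [blockOp]

theorem tendsto_blockOp {ι : Type*} {l : Filter ι}
    {a : ι → E →L[ℂ] E} {b : ι → F →L[ℂ] E} {c : ι → E →L[ℂ] F} {d : ι → F →L[ℂ] F}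
    {A : E →L[ℂ] E} {B : F →L[ℂ] E} {C : E →L[ℂ] F} {D : F →L[ℂ] F}
    (ha : Tendsto a l (nhds A)) (hb : Tendsto b l (nhds B))
    (hc : Tendsto c l (nhds C)) (hd : Tendsto d l (nhds D)) :
    Tendsto (fun i => blockOp (a i) (b i) (c i) (d i)) l (nhds (blockOp A B C D)) := by
  simp only [blockOp_eq_add]
  exact ((tendsto_comp_comp ha _ _).add (tendsto_comp_comp hb _ _)).add
    ((tendsto_comp_comp hc _ _).add (tendsto_comp_comp hd _ _))

/-- Schur-complement formula for the inverse of a block operator: `T` inverts the Schur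
complement `A - B W C`, where `W` inverts `D`. -/
theorem blockOp_schur_inverse {A T : E →L[ℂ] E} {B : F →L[ℂ] E} {C : E →L[ℂ] F}
    {D W : F →L[ℂ] F} (hDW : D * W = 1) (hWD : W * D = 1)
    (hST : (A - B ∘L W ∘L C) * T = 1) (hTS : T * (A - B ∘L W ∘L C) = 1) :
    blockOp A B C D * blockOp T (-(T ∘L B ∘L W)) (-(W ∘L C ∘L T))
        (W + W ∘L C ∘L T ∘L B ∘L W) = 1 ∧
      blockOp T (-(T ∘L B ∘L W)) (-(W ∘L C ∘L T)) (W + W ∘L C ∘L T ∘L B ∘L W) *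
        blockOp A B C D = 1 := by
  have h1 : ∀ y, D (W y) = y := fun y => DFunLike.congr_fun hDW y
  have h2 : ∀ y, W (D y) = y := fun y => DFunLike.congr_fun hWD y
  have h3 : ∀ x, A (T x) = x + B (W (C (T x))) := fun x =>
    sub_eq_iff_eq_add.mp (DFunLike.congr_fun hST x)
  have h4 : ∀ x, T (A x) = x + T (B (W (C x))) := fun x => by
    have h := DFunLike.congr_fun hTS x
    simp only [mul_apply_eq_comp, sub_apply, comp_apply, map_sub, one_apply_eq_self] at h
    exact sub_eq_iff_eq_add.mp h
  constructor
  · rw [blockOp_mul, ← blockOp_one]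
    congr 1 <;> ext x <;> simp [h1, h3]
  · rw [blockOp_mul, ← blockOp_one]
    congr 1 <;> ext x <;> simp [h2, h4]

end BlockOp

theorem tendsto_inv_smul_zero_of_norm_div {V : Type*} [NormedAddCommGroup V] [NormedSpace ℂ V]
    {R : ℝ → V} (h : Tendsto (fun k : ℝ => ‖R k‖ / k) atTop (nhds 0)) :
    Tendsto (fun k : ℝ => (k : ℂ)⁻¹ • R k) atTop (nhds 0) := by
  rw [tendsto_zero_iff_norm_tendsto_zero]
  refine h.congr' ?_
  filter_upwards [eventually_gt_atTop 0] with k hk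
  rw [norm_smul, norm_inv, Complex.norm_of_nonneg hk.le, div_eq_inv_mul]

theorem tendsto_ofReal_inv_atTop : Tendsto (fun k : ℝ => (k : ℂ)⁻¹) atTop (nhds 0) := by
  simpa [Function.comp_def] using (Complex.continuous_ofReal.tendsto 0).comp tendsto_inv_atTop_zero

/-- **Scaled resolvent limit for singularly scaled block operators.**
With `M(k) = [[M11, k M12 + R12(k)], [k M21 + R21(k), k² M22 + R22(k)]]`, `M22`
invertible, the error terms `o(k)`, and `s•I + M̂11` invertible for the Schur
complement `M̂11 = M11 - M12 M22⁻¹ M21`, the operator `s•I + M(k)` is invertible for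
all large `k`, and with `D(k) = diag(I, k I)` the scaled inverse
`D(k)(s•I + M(k))⁻¹D(k)` converges in operator norm to the stated block limit. -/
theorem scaled_resolvent_limit
    {E F : Type*} [NormedAddCommGroup E] [InnerProductSpace ℂ E] [CompleteSpace E]
    [NormedAddCommGroup F] [InnerProductSpace ℂ F] [CompleteSpace F]
    (M11 : E →L[ℂ] E) (M12 : F →L[ℂ] E) (M21 : E →L[ℂ] F) (M22 : F →L[ℂ] F)
    (hM22 : IsUnit M22)
    (R12 : ℝ → (F →L[ℂ] E)) (R21 : ℝ → (E →L[ℂ] F)) (R22 : ℝ → (F →L[ℂ] F))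
    (hR12 : Tendsto (fun k : ℝ => ‖R12 k‖ / k) atTop (nhds 0))
    (hR21 : Tendsto (fun k : ℝ => ‖R21 k‖ / k) atTop (nhds 0))
    (hR22 : Tendsto (fun k : ℝ => ‖R22 k‖ / k) atTop (nhds 0))
    (M : ℝ → (WithLp 2 (E × F) →L[ℂ] WithLp 2 (E × F)))
    (hM : ∀ k : ℝ, M k = blockOp M11 ((k : ℂ) • M12 + R12 k)
        ((k : ℂ) • M21 + R21 k) (((k : ℂ) ^ 2) • M22 + R22 k))
    (s : ℂ)
    (hs : IsUnit (s • (1 : E →L[ℂ] E) + (M11 - M12 ∘L Ring.inverse M22 ∘L M21))) :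
    (∀ᶠ k : ℝ in atTop, IsUnit (s • (1 : WithLp 2 (E × F) →L[ℂ] WithLp 2 (E × F)) + M k)) ∧
      Tendsto (fun k : ℝ =>
          blockOp (1 : E →L[ℂ] E) 0 0 ((k : ℂ) • (1 : F →L[ℂ] F)) *
            Ring.inverse (s • (1 : WithLp 2 (E × F) →L[ℂ] WithLp 2 (E × F)) + M k) *
            blockOp (1 : E →L[ℂ] E) 0 0 ((k : ℂ) • (1 : F →L[ℂ] F)))
        atTop
        (nhds (blockOp
          (Ring.inverse (s • (1 : E →L[ℂ] E) + (M11 - M12 ∘L Ring.inverse M22 ∘L M21)))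
          (-(Ring.inverse (s • (1 : E →L[ℂ] E) + (M11 - M12 ∘L Ring.inverse M22 ∘L M21))
              ∘L M12 ∘L Ring.inverse M22))
          (-(Ring.inverse M22 ∘L M21 ∘L
              Ring.inverse (s • (1 : E →L[ℂ] E) + (M11 - M12 ∘L Ring.inverse M22 ∘L M21))))
          (Ring.inverse M22 + Ring.inverse M22 ∘L M21 ∘L
              Ring.inverse (s • (1 : E →L[ℂ] E) + (M11 - M12 ∘L Ring.inverse M22 ∘L M21))
              ∘L M12 ∘L Ring.inverse M22))) := by
  set T := Ring.inverse (s • (1 : E →L[ℂ] E) + (M11 - M12 ∘L Ring.inverse M22 ∘L M21))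
  set W := Ring.inverse M22
  rw [← add_sub_assoc] at hs
  have hT : T = Ring.inverse (s • (1 : E →L[ℂ] E) + M11 - M12 ∘L W ∘L M21) := by
    rw [add_sub_assoc]
  obtain ⟨hNL, hLN⟩ := blockOp_schur_inverse (Ring.mul_inverse_cancel _ hM22)
    (Ring.inverse_mul_cancel _ hM22) (hT ▸ Ring.mul_inverse_cancel _ hs)
    (hT ▸ Ring.inverse_mul_cancel _ hs)
  set N := blockOp (s • (1 : E →L[ℂ] E) + M11) M12 M21 M22
  set L := blockOp T (-(T ∘L M12 ∘L W)) (-(W ∘L M21 ∘L T)) (W + W ∘L M21 ∘L T ∘L M12 ∘L W)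
  let u : (WithLp 2 (E × F) →L[ℂ] WithLp 2 (E × F))ˣ := ⟨N, L, hNL, hLN⟩
  set Nk : ℝ → (WithLp 2 (E × F) →L[ℂ] WithLp 2 (E × F)) := fun k =>
    blockOp (s • (1 : E →L[ℂ] E) + M11) (M12 + (k : ℂ)⁻¹ • R12 k) (M21 + (k : ℂ)⁻¹ • R21 k)
      (M22 + (k : ℂ)⁻¹ • ((k : ℂ)⁻¹ • R22 k + (k : ℂ)⁻¹ • s • (1 : F →L[ℂ] F))) with hNk
  have hlim : Tendsto Nk atTop (nhds N) := by
    refine tendsto_blockOp tendsto_const_nhds ?_ ?_ ?_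
    · simpa using (tendsto_inv_smul_zero_of_norm_div hR12).const_add M12
    · simpa using (tendsto_inv_smul_zero_of_norm_div hR21).const_add M21
    · simpa using (tendsto_ofReal_inv_atTop.smul
        ((tendsto_inv_smul_zero_of_norm_div hR22).add
          (tendsto_ofReal_inv_atTop.smul_const (s • (1 : F →L[ℂ] F))))).const_add M22
  have hunit : ∀ᶠ k in atTop, IsUnit (Nk k) := hlim.eventually (Units.nhds u)
  set D : ℝ → (WithLp 2 (E × F) →L[ℂ] WithLp 2 (E × F)) := fun k =>
    blockOp (1 : E →L[ℂ] E) 0 0 ((k : ℂ) • (1 : F →L[ℂ] F))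
  have hD : ∀ k : ℝ, k ≠ 0 → IsUnit (D k) := fun k hk => by
    have hk' : (k : ℂ) ≠ 0 := by exact_mod_cast hk
    refine ⟨⟨D k, blockOp 1 0 0 ((k : ℂ)⁻¹ • 1), ?_, ?_⟩, rfl⟩ <;>
    · rw [blockOp_mul, ← blockOp_one]
      congr 1 <;> ext x <;> simp [hk', -Complex.coe_smul]
  have hfac : ∀ k : ℝ, k ≠ 0 →
      s • (1 : WithLp 2 (E × F) →L[ℂ] WithLp 2 (E × F)) + M k = D k * Nk k * D k := by
    intro k hk
    have hk' : (k : ℂ) ≠ 0 := by exact_mod_cast hk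
    rw [hM, smul_one_add_blockOp, hNk, blockOp_mul, blockOp_mul]
    congr 1 <;> ext x <;> simp [hk', smul_smul, pow_two, -Complex.coe_smul]
    have hcancel : (k : ℂ) * ((k : ℂ)⁻¹ * ((k : ℂ)⁻¹ * s) * k) = s := by field_simp
    rw [hcancel]
    abel
  refine ⟨?_, ?_⟩
  · filter_upwards [hunit, eventually_ne_atTop 0] with k hN hk
    rw [hfac k hk]
    exact ((hD k hk).mul hN).mul (hD k hk)
  · have hinv : Tendsto (fun k => Ring.inverse (Nk k)) atTop (nhds L) := by
      have h := (NormedRing.inverse_continuousAt u).tendsto.comp hlim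
      rwa [Ring.inverse_unit] at h
    refine hinv.congr' ?_
    filter_upwards [hunit, eventually_ne_atTop 0] with k hN hk
    obtain ⟨d, hd⟩ := hD k hk
    obtain ⟨n, hn⟩ := hN
    change _ = D k * Ring.inverse _ * D k
    rw [hfac k hk, ← hd, ← hn, ← Units.val_mul, ← Units.val_mul, Ring.inverse_unit,
      Ring.inverse_unit]
    simp [mul_assoc]
end

section
/- Adiabatic limit of the characteristic operator. Let E (slow space), F (fast space) and 𝒦 (field multiplicity space) be complex Hilbert spaces and h := E ⊕ F. Let L⁰ : h → 𝒦 and L¹ : F → 𝒦 be bounded, H⁰ a bounded self-adjoint operator on h, H¹ a bounded self-adjoint operator on h whose EE-block vanishes (P_E∘H¹∘ι_E = 0), H² a bounded self-adjoint operator on F, and S a unitary on 𝒦. For k > 0 set L(k) := L⁰ + k·L¹∘P_F, H(k) := H⁰ + k·H¹ + k²·ι_F∘H²∘P_F, and K(k) := -(1/2)L(k)*L(k) - i·H(k). Define A := -(1/2)L¹*L¹ - iH² on F, Z_sf := -(1/2)(L⁰∘ι_E)*∘L¹ - i·P_E∘H¹∘ι_F : F → E, Z_fs := -(1/2)L¹*∘(L⁰∘ι_E)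 - i·P_F∘H¹∘ι_E : E → F, R_ss := -(1/2)(L⁰∘ι_E)*∘(L⁰∘ι_E) - i·P_E∘H⁰∘ι_E on E, and assume A is invertible; set K̂ := R_ss - Z_sf∘A⁻¹∘Z_fs. Then for every s ∈ ℂ with Re s > 0, the operators s·I - K(k) (for every k) and s·I - K̂ are invertible, and the characteristic operators T_k(s) := S - L(k)∘(s·I - K(k))⁻¹∘L(k)*∘S converge in operator norm as k → ∞ to T̂(s) := (I + L¹∘A⁻¹∘(L¹)*)∘S - (L⁰∘ι_E - L¹∘A⁻¹∘Z_fs)∘(s·I - K̂)⁻¹∘((L⁰∘ι_E)* - Z_sf∘A⁻¹∘(L¹)*)∘S. -/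
open ContinuousLinearMap Filter

/-- Isometric inclusion `E → E ⊕ F` of the first summand of the Hilbert direct sum. -/
noncomputable def inclLeft (E F : Type*)
    [NormedAddCommGroup E] [InnerProductSpace ℂ E]
    [NormedAddCommGroup F] [InnerProductSpace ℂ F] : E →L[ℂ] WithLp 2 (E × F) :=
  (WithLp.prodContinuousLinearEquiv 2 ℂ E F).symm.toContinuousLinearMap ∘L
    ContinuousLinearMap.inl ℂ E F

/-- Isometric inclusion `F → E ⊕ F` of the second summand. -/
noncomputable def inclRight (E F : Type*)
    [NormedAddCommGroup E] [InnerProductSpace ℂ E]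
    [NormedAddCommGroup F] [InnerProductSpace ℂ F] : F →L[ℂ] WithLp 2 (E × F) :=
  (WithLp.prodContinuousLinearEquiv 2 ℂ E F).symm.toContinuousLinearMap ∘L
    ContinuousLinearMap.inr ℂ E F

/-- Orthogonal projection `E ⊕ F → E` onto the first summand. -/
noncomputable def projLeft (E F : Type*)
    [NormedAddCommGroup E] [InnerProductSpace ℂ E]
    [NormedAddCommGroup F] [InnerProductSpace ℂ F] : WithLp 2 (E × F) →L[ℂ] E :=
  ContinuousLinearMap.fst ℂ E F ∘L
    (WithLp.prodContinuousLinearEquiv 2 ℂ E F).toContinuousLinearMap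

/-- Orthogonal projection `E ⊕ F → F` onto the second summand. -/
noncomputable def projRight (E F : Type*)
    [NormedAddCommGroup E] [InnerProductSpace ℂ E]
    [NormedAddCommGroup F] [InnerProductSpace ℂ F] : WithLp 2 (E × F) →L[ℂ] F :=
  ContinuousLinearMap.snd ℂ E F ∘L
    (WithLp.prodContinuousLinearEquiv 2 ℂ E F).toContinuousLinearMap

section Blocks

variable {E F 𝒦 : Type*} [NormedAddCommGroup E] [InnerProductSpace ℂ E]
  [NormedAddCommGroup F] [InnerProductSpace ℂ F]
  [NormedAddCommGroup 𝒦] [InnerProductSpace ℂ 𝒦]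

@[simp] lemma projLeft_inclLeft (x : E) : projLeft E F (inclLeft E F x) = x := rfl

@[simp] lemma projRight_inclRight (x : F) : projRight E F (inclRight E F x) = x := rfl

@[simp] lemma projLeft_inclRight (x : F) : projLeft E F (inclRight E F x) = 0 := rfl

@[simp] lemma projRight_inclLeft (x : E) : projRight E F (inclLeft E F x) = 0 := rfl

lemma inclLeft_projLeft_add_inclRight_projRight (x : WithLp 2 (E × F)) :
    inclLeft E F (projLeft E F x) + inclRight E F (projRight E F x) = x := by
  apply (WithLp.equiv 2 (E × F)).injective
  ext <;> simp [inclLeft, inclRight, projLeft, projRight]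

lemma withLp_prod_ext {x y : WithLp 2 (E × F)} (h₁ : projLeft E F x = projLeft E F y)
    (h₂ : projRight E F x = projRight E F y) : x = y := by
  rw [← inclLeft_projLeft_add_inclRight_projRight x, h₁, h₂,
    inclLeft_projLeft_add_inclRight_projRight]

lemma inner_inclLeft (x : E) (y : WithLp 2 (E × F)) :
    inner ℂ (inclLeft E F x) y = inner ℂ x (projLeft E F y) := by
  simp [inclLeft, projLeft, WithLp.prod_inner_apply]

lemma inner_inclRight (x : F) (y : WithLp 2 (E × F)) :
    inner ℂ (inclRight E F x) y = inner ℂ x (projRight E F y) := by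
  simp [inclRight, projRight, WithLp.prod_inner_apply]

/-- Inverse of a block operator by the Schur complement of its lower right corner `-A`. -/
lemma schur_complement_inverse (A : F →L[ℂ] F) (hA : IsUnit A) (Y : E →L[ℂ] E)
    (Zsf : F →L[ℂ] E) (Zfs : E →L[ℂ] F)
    (hW : IsUnit (Y + Zsf ∘L Ring.inverse A ∘L Zfs)) (B : WithLp 2 (E × F) →L[ℂ] WithLp 2 (E × F))
    (hB : B = inclLeft E F ∘L (Y ∘L projLeft E F - Zsf ∘L projRight E F) -
      inclRight E F ∘L (Zfs ∘L projLeft E F + A ∘L projRight E F)) :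
    IsUnit B ∧ Ring.inverse B =
      (inclLeft E F - inclRight E F ∘L Ring.inverse A ∘L Zfs) ∘L
        Ring.inverse (Y + Zsf ∘L Ring.inverse A ∘L Zfs) ∘L
        (projLeft E F - Zsf ∘L Ring.inverse A ∘L projRight E F) -
      inclRight E F ∘L Ring.inverse A ∘L projRight E F := by
  set V := Ring.inverse A with hV
  set W := Ring.inverse (Y + Zsf ∘L V ∘L Zfs) with hWdef
  have hAV (x : F) : A (V x) = x := DFunLike.congr_fun (Ring.mul_inverse_cancel A hA) x
  have hVA (x : F) : V (A x) = x := DFunLike.congr_fun (Ring.inverse_mul_cancel A hA) x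
  have hYW (x : E) : Y (W x) + Zsf (V (Zfs (W x))) = x :=
    DFunLike.congr_fun (Ring.mul_inverse_cancel _ hW) x
  have hWY (x : E) : W (Y x) + W (Zsf (V (Zfs x))) = x := by
    rw [← map_add]
    exact DFunLike.congr_fun (Ring.inverse_mul_cancel _ hW) x
  set X := (inclLeft E F - inclRight E F ∘L V ∘L Zfs) ∘L W ∘L
    (projLeft E F - Zsf ∘L V ∘L projRight E F) - inclRight E F ∘L V ∘L projRight E F with hX
  have hBX : B * X = 1 := by
    ext1 x
    apply withLp_prod_ext
    · have h := hYW (projLeft E F x - Zsf (V (projRight E F x)))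
      simp only [hB, hX, mul_apply_eq_comp, one_apply_eq_self, comp_apply, sub_apply, add_apply,
        map_sub, map_add, projLeft_inclLeft, projLeft_inclRight, projRight_inclLeft,
        projRight_inclRight, map_zero] at h ⊢
      rw [← sub_eq_zero] at h ⊢
      refine Eq.trans ?_ h
      abel
    · simp only [hB, hX, mul_apply_eq_comp, one_apply_eq_self, comp_apply, sub_apply, add_apply,
        map_sub, map_add, projLeft_inclLeft, projLeft_inclRight, projRight_inclLeft,
        projRight_inclRight, map_zero, hAV]
      abel
  have hXB : X * B = 1 := by
    ext1 x
    have h := hWY (projLeft E F x)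
    have hx : W (Y (projLeft E F x)) = projLeft E F x - W (Zsf (V (Zfs (projLeft E F x)))) :=
      eq_sub_of_add_eq h
    apply withLp_prod_ext <;>
    · simp only [hB, hX, mul_apply_eq_comp, one_apply_eq_self, comp_apply, sub_apply, add_apply,
        map_sub, map_add, projLeft_inclLeft, projLeft_inclRight, projRight_inclLeft,
        projRight_inclRight, map_zero, hVA, hx]
      abel
  exact ⟨⟨⟨B, X, hBX, hXB⟩, rfl⟩, Ring.inverse_unit ⟨B, X, hBX, hXB⟩⟩

variable [CompleteSpace E] [CompleteSpace F] [CompleteSpace 𝒦]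

@[simp] lemma adjoint_projLeft : adjoint (projLeft E F) = inclLeft E F :=
  ((eq_adjoint_iff _ _).2 inner_inclLeft).symm

@[simp] lemma adjoint_projRight : adjoint (projRight E F) = inclRight E F :=
  ((eq_adjoint_iff _ _).2 inner_inclRight).symm

@[simp] lemma adjoint_inclLeft : adjoint (inclLeft E F) = projLeft E F := by
  rw [← adjoint_projLeft, adjoint_adjoint]

@[simp] lemma adjoint_inclRight : adjoint (inclRight E F) = projRight E F := by
  rw [← adjoint_projRight, adjoint_adjoint]

/-- A generator `-(1/2) L*L - iH` with `H` self-adjoint is dissipative. -/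
lemma re_inner_generator_nonpos (L : E →L[ℂ] 𝒦) (H : E →L[ℂ] E) (hH : IsSelfAdjoint H) (x : E) :
    (inner ℂ ((-((1/2 : ℂ) • (adjoint L ∘L L)) - Complex.I • H) x) x).re ≤ 0 := by
  have him : (inner ℂ (H x) x).im = 0 := by
    have h := hH.isSymmetric.coe_reApplyInnerSelf_apply x
    rw [← h]
    exact Complex.ofReal_im _
  have hre : inner ℂ (adjoint L (L x)) x = ((‖L x‖ ^ 2 : ℝ) : ℂ) := by
    rw [adjoint_inner_left, inner_self_eq_norm_sq_to_K]
    push_cast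
    rfl
  simp only [sub_apply, neg_apply, smul_apply, comp_apply, inner_sub_left, inner_neg_left,
    inner_smul_left, hre]
  simp [him]
  norm_cast
  positivity

/-- The open right half-plane lies in the resolvent set of a bounded dissipative operator. -/
lemma isUnit_smul_one_sub_of_re_inner_nonpos (K : E →L[ℂ] E)
    (hK : ∀ x, (inner ℂ (K x) x).re ≤ 0) {s : ℂ} (hs : 0 < s.re) :
    IsUnit (s • (1 : E →L[ℂ] E) - K) := by
  refine isUnit_of_forall_le_norm_inner_map _ (c := ⟨s.re, hs.le⟩) hs fun x => ?_
  refine le_trans ?_ (Complex.re_le_norm _)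
  have hx : (inner ℂ x x : ℂ) = ((‖x‖ ^ 2 : ℝ) : ℂ) := by
    rw [inner_self_eq_norm_sq_to_K]
    push_cast
    rfl
  have := hK x
  simp only [sub_apply, smul_apply, one_apply_eq_self, inner_sub_left, inner_smul_left, hx,
    Complex.sub_re, Complex.mul_re, Complex.ofReal_re, Complex.ofReal_im, Complex.conj_re]
  change ‖x‖ ^ 2 * s.re ≤ _
  linarith

end Blocks

/-- Rescaling `H₀ + k H₁ + k² H₂` by `P + k⁻¹ Q` on both sides removes the divergent terms. -/
lemma rescale_identity {R : Type*} [Ring R] [Algebra ℂ R] (P Q H₀ H₁ H₂ : R) {k ε : ℂ}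
    (hk : k * ε = 1) (hPHP : P * H₁ * P = 0) (hPH : P * H₂ = 0) (hHP : H₂ * P = 0)
    (hQH : Q * H₂ = H₂) (hHQ : H₂ * Q = H₂) :
    (P + ε • Q) * (H₀ + k • H₁ + k ^ 2 • H₂) * (P + ε • Q) =
      (P * H₀ * P + P * H₁ * Q + Q * H₁ * P + H₂) +
        ε • (P * H₀ * Q + Q * H₀ * P + Q * H₁ * Q) + ε ^ 2 • (Q * H₀ * Q) := by
  have h₁ : ε * k = 1 := by rw [mul_comm, hk]
  have h₂ : ε * (k ^ 2 * ε) = 1 := by linear_combination (k * ε + 1) * hk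
  simp only [add_mul, mul_add, smul_mul_assoc, mul_smul_comm, smul_add, smul_smul, hPHP, hPH, hHP,
    hQH, hHQ, smul_zero, hk, h₁, h₂, one_smul, add_zero, zero_add, ← pow_two]
  abel

lemma isUnit_add_smul_of_idempotents {R : Type*} [Ring R] [Algebra ℂ R] {P Q : R} {k ε : ℂ}
    (hk : k * ε = 1) (hPP : P * P = P) (hQQ : Q * Q = Q) (hPQ : P * Q = 0) (hQP : Q * P = 0)
    (h : P + Q = 1) : IsUnit (P + ε • Q) := by
  have hk' : ε * k = 1 := by rw [mul_comm, hk]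
  refine ⟨⟨P + ε • Q, P + k • Q, ?_, ?_⟩, rfl⟩ <;>
  simp [add_mul, mul_add, smul_smul, hPP, hPQ, hQP, hQQ, hk, hk', h]

lemma add_smul_mul_self_of_idempotents {R : Type*} [Ring R] [Algebra ℂ R] {P Q : R} (ε : ℂ)
    (hPP : P * P = P) (hQQ : Q * Q = Q) (hPQ : P * Q = 0) (hQP : Q * P = 0) :
    (P + ε • Q) * (P + ε • Q) = P + ε ^ 2 • Q := by
  simp [add_mul, mul_add, smul_smul, hPP, hPQ, hQP, hQQ, pow_two]

lemma conj_smul_one_sub_generator {R : Type*} [Ring R] [Algebra ℂ R] (D X H : R) (s a b : ℂ) :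
    D * (s • (1 : R) - (-(a • X) - b • H)) * D =
      s • (D * D) + a • (D * X * D) + b • (D * H * D) := by
  simp only [mul_sub, sub_mul, mul_neg, neg_mul, mul_smul_comm, smul_mul_assoc, mul_one]
  abel

/-- Conjugating by an invertible `D` inside a resolvent. -/
lemma inverse_eq_conj {R : Type*} [Ring R] {D X : R} (hD : IsUnit D) (hX : IsUnit X) :
    Ring.inverse X = D * Ring.inverse (D * X * D) * D := by
  obtain ⟨d, rfl⟩ := hD
  obtain ⟨x, rfl⟩ := hX
  rw [← Units.val_mul, ← Units.val_mul, Ring.inverse_unit, Ring.inverse_unit, ← Units.val_mul,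
    ← Units.val_mul]
  congr 1
  group

set_option maxHeartbeats 2000000 in
/-- **Adiabatic limit of the characteristic operator.** With
`L(k) = L⁰ + k L¹ P_F`, `H(k) = H⁰ + k H¹ + k² ι_F H² P_F` (with `H¹` having vanishing
`EE`-block), generator `K(k) = -(1/2)L(k)*L(k) - iH(k)`, invertible
`A = -(1/2)(L¹)*L¹ - iH²`, and `K̂ = R_ss - Z_sf A⁻¹ Z_fs`, for every `s` with
`Re s > 0` the operators `s•I - K(k)` and `s•I - K̂` are invertible and the
characteristic operators `T_k(s)` converge in operator norm to `T̂(s)`. -/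
theorem adiabatic_limit_characteristic_operator
    {E F 𝒦 : Type*} [NormedAddCommGroup E] [InnerProductSpace ℂ E] [CompleteSpace E]
    [NormedAddCommGroup F] [InnerProductSpace ℂ F] [CompleteSpace F]
    [NormedAddCommGroup 𝒦] [InnerProductSpace ℂ 𝒦] [CompleteSpace 𝒦]
    (L0 : WithLp 2 (E × F) →L[ℂ] 𝒦) (L1 : F →L[ℂ] 𝒦)
    (H0 H1 : WithLp 2 (E × F) →L[ℂ] WithLp 2 (E × F)) (H2 : F →L[ℂ] F)
    (S : 𝒦 →L[ℂ] 𝒦)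
    (hS : adjoint S * S = 1 ∧ S * adjoint S = 1)
    (hH0 : IsSelfAdjoint H0) (hH1 : IsSelfAdjoint H1) (hH2 : IsSelfAdjoint H2)
    (hH1EE : projLeft E F ∘L H1 ∘L inclLeft E F = 0)
    (Lk : ℝ → (WithLp 2 (E × F) →L[ℂ] 𝒦))
    (hLk : ∀ k : ℝ, Lk k = L0 + (k : ℂ) • (L1 ∘L projRight E F))
    (Hk : ℝ → (WithLp 2 (E × F) →L[ℂ] WithLp 2 (E × F)))
    (hHk : ∀ k : ℝ, Hk k = H0 + (k : ℂ) • H1 +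
        ((k : ℂ) ^ 2) • (inclRight E F ∘L H2 ∘L projRight E F))
    (Kk : ℝ → (WithLp 2 (E × F) →L[ℂ] WithLp 2 (E × F)))
    (hKk : ∀ k : ℝ, Kk k = -((1/2 : ℂ) • (adjoint (Lk k) ∘L Lk k)) - Complex.I • Hk k)
    (A : F →L[ℂ] F)
    (hA : A = -((1/2 : ℂ) • (adjoint L1 ∘L L1)) - Complex.I • H2)
    (hAinv : IsUnit A)
    (Zsf : F →L[ℂ] E)
    (hZsf : Zsf = -((1/2 : ℂ) • (adjoint (L0 ∘L inclLeft E F) ∘L L1)) -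
        Complex.I • (projLeft E F ∘L H1 ∘L inclRight E F))
    (Zfs : E →L[ℂ] F)
    (hZfs : Zfs = -((1/2 : ℂ) • (adjoint L1 ∘L (L0 ∘L inclLeft E F))) -
        Complex.I • (projRight E F ∘L H1 ∘L inclLeft E F))
    (Rss : E →L[ℂ] E)
    (hRss : Rss = -((1/2 : ℂ) • (adjoint (L0 ∘L inclLeft E F) ∘L (L0 ∘L inclLeft E F))) -
        Complex.I • (projLeft E F ∘L H0 ∘L inclLeft E F))
    (Khat : E →L[ℂ] E)
    (hKhat : Khat = Rss - Zsf ∘L Ring.inverse A ∘L Zfs) :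
    ∀ s : ℂ, 0 < s.re →
      (∀ k : ℝ, IsUnit (s • (1 : WithLp 2 (E × F) →L[ℂ] WithLp 2 (E × F)) - Kk k)) ∧
      IsUnit (s • (1 : E →L[ℂ] E) - Khat) ∧
      Tendsto (fun k : ℝ =>
          S - Lk k ∘L
            Ring.inverse (s • (1 : WithLp 2 (E × F) →L[ℂ] WithLp 2 (E × F)) - Kk k)
            ∘L adjoint (Lk k) ∘L S)
        atTop
        (nhds (((1 : 𝒦 →L[ℂ] 𝒦) + L1 ∘L Ring.inverse A ∘L adjoint L1) ∘L S -
          (L0 ∘L inclLeft E F - L1 ∘L Ring.inverse A ∘L Zfs) ∘L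
            Ring.inverse (s • (1 : E →L[ℂ] E) - Khat) ∘L
            (adjoint (L0 ∘L inclLeft E F) - Zsf ∘L Ring.inverse A ∘L adjoint L1) ∘L S)) := by
  intro s hs
  have hHkS (k : ℝ) : IsSelfAdjoint (Hk k) := by
    rw [isSelfAdjoint_iff', hHk]
    simp only [map_add, map_smulₛₗ, adjoint_comp, comp_assoc, adjoint_inclRight,
      adjoint_projRight, map_pow, Complex.conj_ofReal, hH0.adjoint_eq, hH1.adjoint_eq,
      hH2.adjoint_eq]
  have hunit (k : ℝ) : IsUnit (s • (1 : WithLp 2 (E × F) →L[ℂ] WithLp 2 (E × F)) - Kk k) := by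
    rw [hKk]
    exact isUnit_smul_one_sub_of_re_inner_nonpos _
      (re_inner_generator_nonpos _ _ (hHkS k)) hs
  set P : WithLp 2 (E × F) →L[ℂ] WithLp 2 (E × F) := inclLeft E F ∘L projLeft E F with hP
  set Q : WithLp 2 (E × F) →L[ℂ] WithLp 2 (E × F) := inclRight E F ∘L projRight E F with hQ
  set J : WithLp 2 (E × F) →L[ℂ] WithLp 2 (E × F) :=
    inclRight E F ∘L H2 ∘L projRight E F with hJ
  set N : WithLp 2 (E × F) →L[ℂ] 𝒦 := L0 ∘L P + L1 ∘L projRight E F with hN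
  set G := P * H0 * P + P * H1 * Q + Q * H1 * P + J with hG
  clear_value G N J
  have hPadj : adjoint P = P := by
    simp only [hP, adjoint_comp, adjoint_inclLeft, adjoint_projLeft]
  have hQadj : adjoint Q = Q := by
    simp only [hQ, adjoint_comp, adjoint_inclRight, adjoint_projRight]
  have hJadj : adjoint J = J := by
    simp only [hJ, adjoint_comp, comp_assoc, adjoint_inclRight, adjoint_projRight,
      hH2.adjoint_eq]
  have hNadj : adjoint N = inclLeft E F ∘L adjoint (L0 ∘L inclLeft E F) +
      inclRight E F ∘L adjoint L1 := by
    simp only [hN, hP, map_add, adjoint_comp, comp_assoc, adjoint_inclLeft, adjoint_projLeft,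
      adjoint_projRight]
  have hGadj : IsSelfAdjoint G := by
    rw [isSelfAdjoint_iff']
    simp only [hG, map_add, mul_def, adjoint_comp, hPadj, hQadj, hJadj, hH0.adjoint_eq,
      hH1.adjoint_eq, comp_assoc]
    abel
  have hM : -((1/2 : ℂ) • (adjoint N ∘L N)) - Complex.I • G =
      inclLeft E F ∘L (Rss ∘L projLeft E F + Zsf ∘L projRight E F) +
      inclRight E F ∘L (Zfs ∘L projLeft E F + A ∘L projRight E F) := by
    rw [hNadj, hRss, hZsf, hZfs, hA, hG, hN, hP, hQ, hJ]
    generalize adjoint (L0 ∘L inclLeft E F) = L0', adjoint L1 = L1'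
    ext1 x
    apply withLp_prod_ext <;>
    · simp only [mul_apply_eq_comp, comp_apply, sub_apply, add_apply, neg_apply, smul_apply,
        map_sub, map_add, map_neg, map_smul, projLeft_inclLeft, projLeft_inclRight, projRight_inclLeft,
        projRight_inclRight, smul_add, smul_zero, add_zero, zero_add]
      abel
  have hAV (x : F) : A (Ring.inverse A x) = x := DFunLike.congr_fun (Ring.mul_inverse_cancel A hAinv) x
  have hKhatUnit : IsUnit (s • (1 : E →L[ℂ] E) - Khat) := by
    refine isUnit_smul_one_sub_of_re_inner_nonpos _ (fun x => ?_) hs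
    have h := re_inner_generator_nonpos N G hGadj
      (inclLeft E F x - inclRight E F (Ring.inverse A (Zfs x)))
    rw [hM] at h
    convert h using 2
    have hy : (inclLeft E F ∘L (Rss ∘L projLeft E F + Zsf ∘L projRight E F) +
        inclRight E F ∘L (Zfs ∘L projLeft E F + A ∘L projRight E F))
          (inclLeft E F x - inclRight E F (Ring.inverse A (Zfs x))) = inclLeft E F (Khat x) := by
      simp [hKhat, hAV, sub_eq_add_neg]
    rw [hy, inner_inclLeft]
    simp
  set B := s • P + (1/2 : ℂ) • (adjoint N ∘L N) + Complex.I • G with hB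
  have hY : s • (1 : E →L[ℂ] E) - Khat = (s • (1 : E →L[ℂ] E) - Rss) +
      Zsf ∘L Ring.inverse A ∘L Zfs := by
    rw [hKhat]; abel
  obtain ⟨hBunit, hBinv⟩ := schur_complement_inverse A hAinv (s • (1 : E →L[ℂ] E) - Rss) Zsf Zfs
    (hY ▸ hKhatUnit) B (by
      have : B = s • P - (-((1/2 : ℂ) • (adjoint N ∘L N)) - Complex.I • G) := by
        rw [hB]; abel
      rw [this, hM, hP]
      ext1 x
      simp only [comp_apply, sub_apply, add_apply, smul_apply, one_apply_eq_self, map_sub, map_add,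
        map_smul]
      abel)
  rw [← hY] at hBinv
  refine ⟨hunit, hKhatUnit, ?_⟩
  -- the rescaled coupling and the rescaled resolvent are polynomial in `ε = k⁻¹`
  set N' : ℂ → (WithLp 2 (E × F) →L[ℂ] 𝒦) := fun ε => N + ε • (L0 ∘L Q) with hN'
  set B' : ℂ → (WithLp 2 (E × F) →L[ℂ] WithLp 2 (E × F)) := fun ε =>
    s • (P + ε ^ 2 • Q) + (1/2 : ℂ) • (adjoint (N' ε) ∘L N' ε) + Complex.I •
      (G + ε • (P * H0 * Q + Q * H0 * P + Q * H1 * Q) + ε ^ 2 • (Q * H0 * Q)) with hB'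
  have hN'cont : Continuous N' := by fun_prop
  have hN'adj : Continuous fun ε => adjoint (N' ε) := adjoint.continuous.comp hN'cont
  have hB'cont : Continuous B' := by
    have h := hN'adj.clm_comp hN'cont
    fun_prop
  have hN'0 : N' 0 = N := by simp [hN']
  have hB'0 : B' 0 = B := by
    have h₀ (X : WithLp 2 (E × F) →L[ℂ] WithLp 2 (E × F)) : (0 : ℂ) • X = 0 := zero_smul ℂ X
    have h₂ : (0 : ℂ) ^ 2 = 0 := zero_pow two_ne_zero
    rw [hB', hB]
    beta_reduce
    rw [hN'0, h₂, h₀, h₀, h₀, add_zero, add_zero, add_zero]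
  have hPP : P * P = P := by ext1 x; simp [hP]
  have hPQ : P * Q = 0 := by ext1 x; simp [hP, hQ]
  have hQP : Q * P = 0 := by ext1 x; simp [hP, hQ]
  have hQQ : Q * Q = Q := by ext1 x; simp [hQ]
  have hPQ1 : P + Q = 1 := by
    ext1 x
    exact inclLeft_projLeft_add_inclRight_projRight x
  have hT : Tendsto (fun ε : ℂ => S - N' ε ∘L Ring.inverse (B' ε) ∘L adjoint (N' ε) ∘L S)
      (nhds 0) (nhds (S - N ∘L Ring.inverse B ∘L adjoint N ∘L S)) := by
    have hinv : ContinuousAt (fun ε => Ring.inverse (B' ε)) 0 := by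
      obtain ⟨u, hu⟩ := hBunit
      refine ContinuousAt.comp (g := Ring.inverse) ?_ hB'cont.continuousAt
      rw [hB'0, ← hu]
      exact NormedRing.inverse_continuousAt u
    have h : ContinuousAt (fun ε : ℂ => S - N' ε ∘L Ring.inverse (B' ε) ∘L adjoint (N' ε) ∘L S)
        0 :=
      continuousAt_const.sub (hN'cont.continuousAt.clm_comp
        (hinv.clm_comp (hN'adj.continuousAt.clm_comp continuousAt_const)))
    have h' := h.tendsto
    rwa [hN'0, hB'0] at h'
  have hε : Tendsto (fun k : ℝ => ((k⁻¹ : ℝ) : ℂ)) atTop (nhds 0) := by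
    have := (Complex.continuous_ofReal.tendsto 0).comp tendsto_inv_atTop_zero
    rwa [Complex.ofReal_zero] at this
  have hlim := hT.comp hε
  have htarget : S - N ∘L Ring.inverse B ∘L adjoint N ∘L S =
      ((1 : 𝒦 →L[ℂ] 𝒦) + L1 ∘L Ring.inverse A ∘L adjoint L1) ∘L S -
          (L0 ∘L inclLeft E F - L1 ∘L Ring.inverse A ∘L Zfs) ∘L
            Ring.inverse (s • (1 : E →L[ℂ] E) - Khat) ∘L
            (adjoint (L0 ∘L inclLeft E F) - Zsf ∘L Ring.inverse A ∘L adjoint L1) ∘L S := by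
    rw [hBinv, hNadj, hN, hP]
    ext1 x
    simp only [comp_apply, sub_apply, add_apply, one_apply_eq_self, map_sub, map_add,
      projLeft_inclLeft, projLeft_inclRight, projRight_inclLeft, projRight_inclRight, map_zero,
      add_zero, zero_add]
    abel
  rw [← htarget]
  refine hlim.congr' ?_
  filter_upwards [eventually_gt_atTop 0] with k hk
  have hk0 : (k : ℂ) ≠ 0 := by exact_mod_cast hk.ne'
  set ε : ℂ := ((k⁻¹ : ℝ) : ℂ) with hεdef
  have hkε : (k : ℂ) * ε = 1 := by
    rw [hεdef]; push_cast; exact mul_inv_cancel₀ hk0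
  have hεk : ε * (k : ℂ) = 1 := by rw [mul_comm, hkε]
  set D := P + ε • Q with hD
  have hDadj : adjoint D = D := by
    rw [hD, map_add, map_smulₛₗ, hPadj, hQadj, hεdef, starRingEnd_apply, ← starRingEnd_apply,
      Complex.conj_ofReal]
  have hDunit : IsUnit D := isUnit_add_smul_of_idempotents hkε hPP hQQ hPQ hQP hPQ1
  have hLD : Lk k ∘L D = N' ε := by
    ext1 x
    simp only [hLk, hD, hN', hN, hP, hQ, comp_apply, add_apply, smul_apply, map_add, map_smul,
      projRight_inclLeft, projRight_inclRight, map_zero, smul_add, smul_zero, smul_smul,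
      hεk, one_smul]
    abel
  have hLD' : D ∘L adjoint (Lk k) = adjoint (N' ε) := by
    rw [← hLD, adjoint_comp, hDadj]
  have hDHD : D * Hk k * D =
      G + ε • (P * H0 * Q + Q * H0 * P + Q * H1 * Q) + ε ^ 2 • (Q * H0 * Q) := by
    rw [hHk, hG]
    refine rescale_identity P Q H0 H1 J hkε ?_ ?_ ?_ ?_ ?_
    · ext1 x
      have h := DFunLike.congr_fun hH1EE (projLeft E F x)
      simp only [comp_apply, zero_apply] at h
      simp [hP, h]
    all_goals
      ext1 x
      simp [hP, hQ, hJ]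
  have hDD : D * D = P + ε ^ 2 • Q := add_smul_mul_self_of_idempotents ε hPP hQQ hPQ hQP
  have hDLLD : D * (adjoint (Lk k) ∘L Lk k) * D = adjoint (N' ε) ∘L N' ε := by
    rw [← hLD', ← hLD]
    rfl
  have hDBD : D * (s • (1 : WithLp 2 (E × F) →L[ℂ] WithLp 2 (E × F)) - Kk k) * D = B' ε := by
    rw [hKk, conj_smul_one_sub_generator, hDD, hDLLD, hDHD]
  rw [inverse_eq_conj hDunit (hunit k), hDBD]
  simp only [Function.comp_apply, ← hεdef, ← hLD']
  rw [← hLD]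
  rfl
end

section
/- The limit characteristic operator is itself a characteristic operator. Assume the adiabatic block data (L⁰, L¹, Z_sf, Z_fs, A, H⁰) on (E, F, 𝒦) with the structural identities A + A* = -(L¹)*L¹ and Z_sf + (Z_fs)* = -(L⁰)*L¹, and let S be a unitary on 𝒦. Define Ŝ := (I + L¹∘A⁻¹∘(L¹)*)∘S, L̂ := L⁰ - L¹∘A⁻¹∘Z_fs, Ĥ := H⁰ + Im(Z_sf∘A⁻¹∘Z_fs), R := -(1/2)(L⁰)*L⁰ - iH⁰, and K̂ := R - Z_sf∘A⁻¹∘Z_fs. Then for every s ∈ ℂ such that s·I - K̂ is invertible on E, one has the identity (I + L¹∘A⁻¹∘(L¹)*)∘S - L̂∘(s·I - K̂)⁻¹∘((L⁰)* - Z_sf∘A⁻¹∘(L¹)*)∘S = Ŝ - L̂∘(s·I - K̂)⁻¹∘(L̂)*∘Ŝ, and moreover K̂ = -(1/2)(L̂)*L̂ - iĤ; that is, the limit characteristic operator is the characteristic operator of the reduced SLH triple (Ŝ, L̂, Ĥ). -/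
open ContinuousLinearMap

/-- If `A` is invertible with `A + A* = -C*C`, then `(A⁻¹)* C*C A⁻¹ = -(A⁻¹ + (A⁻¹)*)`. -/
theorem adjoint_inverse_comp_gram_comp_inverse
    {F 𝒦 : Type*} [NormedAddCommGroup F] [InnerProductSpace ℂ F] [CompleteSpace F]
    [NormedAddCommGroup 𝒦] [InnerProductSpace ℂ 𝒦] [CompleteSpace 𝒦]
    {A : F →L[ℂ] F} {C : F →L[ℂ] 𝒦} (hA : IsUnit A)
    (hAA : A + adjoint A = -(adjoint C ∘L C)) :
    adjoint (Ring.inverse A) * (adjoint C ∘L C) * Ring.inverse A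
      = -(Ring.inverse A + adjoint (Ring.inverse A)) := by
  have hinv : A * Ring.inverse A = 1 := Ring.mul_inverse_cancel A hA
  have hinv_adjoint : adjoint (Ring.inverse A) * adjoint A = 1 := by
    rw [← star_eq_adjoint, ← star_eq_adjoint, ← star_mul, hinv, star_one]
  rw [← neg_eq_iff_eq_neg.mpr hAA, mul_neg, neg_mul, mul_add, add_mul, hinv_adjoint, mul_assoc,
    hinv, mul_one, one_mul, add_comm]

/-- **The limit characteristic operator is itself a characteristic
operator.** For adiabatic block data `(L⁰, L¹, Z_sf, Z_fs, A, H⁰)` with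
`A + A* = -(L¹)*L¹` and `Z_sf + (Z_fs)* = -(L⁰)*L¹`, and a unitary `S`, setting
`Ŝ = (I + L¹A⁻¹(L¹)*) S`, `L̂ = L⁰ - L¹A⁻¹Z_fs`, `Ĥ = H⁰ + Im(Z_sf A⁻¹ Z_fs)`,
`R = -(1/2)(L⁰)*L⁰ - iH⁰` and `K̂ = R - Z_sf A⁻¹ Z_fs`, one has, whenever `s•I - K̂`
is invertible,
`(I + L¹A⁻¹(L¹)*) S - L̂ (s•I - K̂)⁻¹ ((L⁰)* - Z_sf A⁻¹ (L¹)*) S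
  = Ŝ - L̂ (s•I - K̂)⁻¹ (L̂)* Ŝ`, and `K̂ = -(1/2)(L̂)*L̂ - iĤ`. -/
theorem limit_characteristic_operator_is_characteristic
    {E F 𝒦 : Type*} [NormedAddCommGroup E] [InnerProductSpace ℂ E] [CompleteSpace E]
    [NormedAddCommGroup F] [InnerProductSpace ℂ F] [CompleteSpace F]
    [NormedAddCommGroup 𝒦] [InnerProductSpace ℂ 𝒦] [CompleteSpace 𝒦]
    (L0 : E →L[ℂ] 𝒦) (L1 : F →L[ℂ] 𝒦) (Zsf : F →L[ℂ] E) (Zfs : E →L[ℂ] F)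
    (A : F →L[ℂ] F) (H0 : E →L[ℂ] E)
    (hA : IsUnit A) (hH0 : IsSelfAdjoint H0)
    (hAA : A + adjoint A = -(adjoint L1 ∘L L1))
    (hZZ : Zsf + adjoint Zfs = -(adjoint L0 ∘L L1))
    (S : 𝒦 →L[ℂ] 𝒦) (hS : adjoint S * S = 1 ∧ S * adjoint S = 1)
    (Shat : 𝒦 →L[ℂ] 𝒦)
    (hShat : Shat = ((1 : 𝒦 →L[ℂ] 𝒦) + L1 ∘L Ring.inverse A ∘L adjoint L1) ∘L S)
    (Lhat : E →L[ℂ] 𝒦) (hLhat : Lhat = L0 - L1 ∘L Ring.inverse A ∘L Zfs)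
    (Hhat : E →L[ℂ] E)
    (hHhat : Hhat = H0 + (2 * Complex.I)⁻¹ •
        ((Zsf ∘L Ring.inverse A ∘L Zfs) - adjoint (Zsf ∘L Ring.inverse A ∘L Zfs)))
    (R : E →L[ℂ] E) (hR : R = -((1/2 : ℂ) • (adjoint L0 ∘L L0)) - Complex.I • H0)
    (Khat : E →L[ℂ] E) (hKhat : Khat = R - Zsf ∘L Ring.inverse A ∘L Zfs) :
    (∀ s : ℂ, IsUnit (s • (1 : E →L[ℂ] E) - Khat) →
      ((1 : 𝒦 →L[ℂ] 𝒦) + L1 ∘L Ring.inverse A ∘L adjoint L1) ∘L S -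
          Lhat ∘L Ring.inverse (s • (1 : E →L[ℂ] E) - Khat)
            ∘L (adjoint L0 - Zsf ∘L Ring.inverse A ∘L adjoint L1) ∘L S
        = Shat - Lhat ∘L Ring.inverse (s • (1 : E →L[ℂ] E) - Khat)
            ∘L adjoint Lhat ∘L Shat) ∧
      Khat = -((1/2 : ℂ) • (adjoint Lhat ∘L Lhat)) - Complex.I • Hhat := by
  have gram : ∀ y, adjoint (Ring.inverse A) (adjoint L1 (L1 (Ring.inverse A y)))
      = -(Ring.inverse A y + adjoint (Ring.inverse A) y) := fun y =>
    DFunLike.congr_fun (adjoint_inverse_comp_gram_comp_inverse hA hAA) y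
  have cross : ∀ y, adjoint L0 (L1 y) = -(Zsf y + adjoint Zfs y) := fun y =>
    DFunLike.congr_fun (neg_eq_iff_eq_neg.mpr hZZ).symm y
  have cross_adjoint : ∀ x, adjoint L1 (L0 x) = -(adjoint Zsf x + Zfs x) := by
    have h := congrArg adjoint hZZ
    simp only [map_add, map_neg, adjoint_comp, adjoint_adjoint] at h
    exact fun x => DFunLike.congr_fun (neg_eq_iff_eq_neg.mpr h).symm x
  have coupling : adjoint Lhat ∘L ((1 : 𝒦 →L[ℂ] 𝒦) + L1 ∘L Ring.inverse A ∘L adjoint L1)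
      = adjoint L0 - Zsf ∘L Ring.inverse A ∘L adjoint L1 := by
    ext x
    simp only [hLhat, map_sub, adjoint_comp, comp_apply, add_apply, sub_apply,
      one_apply_eq_self,
      map_add, gram, cross, map_neg]
    abel
  have gram_hat : adjoint Lhat ∘L Lhat = adjoint L0 ∘L L0 + Zsf ∘L Ring.inverse A ∘L Zfs
      + adjoint (Zsf ∘L Ring.inverse A ∘L Zfs) := by
    ext x
    simp only [hLhat, map_sub, adjoint_comp, comp_apply, add_apply, sub_apply,
      map_add, gram, cross, cross_adjoint, map_neg]
    abel
  refine ⟨fun s _ => ?_, ?_⟩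
  · rw [hShat, ← coupling]
    rfl
  · have hI : Complex.I * (2 * Complex.I)⁻¹ = 1 / 2 := by
      field_simp
    rw [gram_hat, hKhat, hR, hHhat, smul_add Complex.I, smul_smul, hI]
    module
end

section
/- Unitarity of the reduced scattering operator. Let F and 𝒦 be complex Hilbert spaces, L : F → 𝒦 a bounded operator, and A an invertible bounded operator on F satisfying A + A* = -L*L. Then the bounded operator T̂ := I + L∘A⁻¹∘L* on 𝒦 is unitary: (T̂)*∘T̂ = I and T̂∘(T̂)* = I. Consequently, for any unitary S on 𝒦 the operator Ŝ := (I + L∘A⁻¹∘L*)∘S is unitary. -/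
open ContinuousLinearMap

/-- If `B + C = -C L* L B`, then `I + L C L*` is a left inverse of `I + L B L*`. -/
theorem one_add_conj_mul_one_add_conj
    {F 𝒦 : Type*} [NormedAddCommGroup F] [InnerProductSpace ℂ F] [CompleteSpace F]
    [NormedAddCommGroup 𝒦] [InnerProductSpace ℂ 𝒦] [CompleteSpace 𝒦]
    (L : F →L[ℂ] 𝒦) (B C : F →L[ℂ] F) (h : B + C = C * -(adjoint L ∘L L) * B) :
    ((1 : 𝒦 →L[ℂ] 𝒦) + L ∘L C ∘L adjoint L) *
      ((1 : 𝒦 →L[ℂ] 𝒦) + L ∘L B ∘L adjoint L) = 1 := by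
  ext x
  have hx := congrArg L (DFunLike.congr_fun h (adjoint L x))
  simp only [add_apply, mul_apply_eq_comp, neg_apply, comp_apply, map_add, map_neg] at hx
  simp only [add_apply, mul_apply_eq_comp, one_apply_eq_self, comp_apply, map_add]
  rw [eq_neg_iff_add_eq_zero] at hx
  rw [add_assoc, add_eq_left, ← hx]
  abel

/-- **Unitarity of the reduced scattering operator.** If `L : F → 𝒦` is
bounded and `A` is an invertible bounded operator on `F` with `A + A* = -L*L`, then
`T̂ = I + L A⁻¹ L*` is unitary on `𝒦`; consequently `Ŝ = T̂ S` is unitary for any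
unitary `S` on `𝒦`. -/
theorem reduced_scattering_unitary
    {F 𝒦 : Type*} [NormedAddCommGroup F] [InnerProductSpace ℂ F] [CompleteSpace F]
    [NormedAddCommGroup 𝒦] [InnerProductSpace ℂ 𝒦] [CompleteSpace 𝒦]
    (L : F →L[ℂ] 𝒦) (A : F →L[ℂ] F)
    (hA : IsUnit A)
    (hAA : A + adjoint A = -(adjoint L ∘L L)) :
    (adjoint ((1 : 𝒦 →L[ℂ] 𝒦) + L ∘L Ring.inverse A ∘L adjoint L) *
        ((1 : 𝒦 →L[ℂ] 𝒦) + L ∘L Ring.inverse A ∘L adjoint L) = 1 ∧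
      ((1 : 𝒦 →L[ℂ] 𝒦) + L ∘L Ring.inverse A ∘L adjoint L) *
        adjoint ((1 : 𝒦 →L[ℂ] 𝒦) + L ∘L Ring.inverse A ∘L adjoint L) = 1) ∧
      ∀ S : 𝒦 →L[ℂ] 𝒦, adjoint S * S = 1 → S * adjoint S = 1 →
        (adjoint (((1 : 𝒦 →L[ℂ] 𝒦) + L ∘L Ring.inverse A ∘L adjoint L) ∘L S) *
            ((((1 : 𝒦 →L[ℂ] 𝒦) + L ∘L Ring.inverse A ∘L adjoint L)) ∘L S) = 1 ∧
          (((1 : 𝒦 →L[ℂ] 𝒦) + L ∘L Ring.inverse A ∘L adjoint L) ∘L S) *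
            adjoint (((1 : 𝒦 →L[ℂ] 𝒦) + L ∘L Ring.inverse A ∘L adjoint L) ∘L S) = 1) := by
  set B := Ring.inverse A
  have hAB : A * B = 1 := Ring.mul_inverse_cancel A hA
  have hBA : B * A = 1 := Ring.inverse_mul_cancel A hA
  have hAB' : adjoint B * adjoint A = 1 := by
    simpa only [star_mul, star_one, star_eq_adjoint] using congrArg star hAB
  have hBA' : adjoint A * adjoint B = 1 := by
    simpa only [star_mul, star_one, star_eq_adjoint] using congrArg star hBA
  have hT : adjoint ((1 : 𝒦 →L[ℂ] 𝒦) + L ∘L B ∘L adjoint L) =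
      1 + L ∘L adjoint B ∘L adjoint L := by
    rw [map_add, adjoint_comp, adjoint_comp, adjoint_adjoint, ← star_eq_adjoint 1, star_one,
      comp_assoc]
  have hleft : adjoint ((1 : 𝒦 →L[ℂ] 𝒦) + L ∘L B ∘L adjoint L) *
      ((1 : 𝒦 →L[ℂ] 𝒦) + L ∘L B ∘L adjoint L) = 1 := by
    rw [hT]
    apply one_add_conj_mul_one_add_conj
    rw [← hAA, mul_add, add_mul, hAB', mul_assoc, hAB, mul_one, one_mul, add_comm]
  have hright : ((1 : 𝒦 →L[ℂ] 𝒦) + L ∘L B ∘L adjoint L) *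
      adjoint ((1 : 𝒦 →L[ℂ] 𝒦) + L ∘L B ∘L adjoint L) = 1 := by
    rw [hT]
    apply one_add_conj_mul_one_add_conj
    rw [← hAA, mul_add, add_mul, hBA, mul_assoc B, hBA', mul_one, one_mul]
  refine ⟨⟨hleft, hright⟩, fun S hS hS' => ?_⟩
  exact Unitary.mem_iff.mp (mul_mem (Unitary.mem_iff.mpr ⟨hleft, hright⟩)
    (Unitary.mem_iff.mpr ⟨hS, hS'⟩))
end

section
/- Schur complement form of the reduced generator. Assume the adiabatic block data (L⁰, L¹, Z_sf, Z_fs, A, H⁰) on (E, F, 𝒦) with the structural identities A + A* = -(L¹)*L¹ and Z_sf + (Z_fs)* = -(L⁰)*L¹. Define L̂ := L⁰ - L¹∘A⁻¹∘Z_fs : E → 𝒦 and Ĥ := H⁰ + Im(Z_sf∘A⁻¹∘Z_fs) on E. Then -(1/2)(L̂)*L̂ - i·Ĥ = (-(1/2)(L⁰)*L⁰ - i·H⁰) - Z_sf∘A⁻¹∘Z_fs; that is, the generator of the reduced pair (L̂, Ĥ) is the Schur complement R - Z_sf∘A⁻¹∘Z_fs of the unreduced generator, where R := -(1/2)(L⁰)*L⁰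 - iH⁰. -/
open ContinuousLinearMap

/-- If `A W = Zfs`, the structural identities make `(L0 - L1 W)* (L0 - L1 W)` differ from
`L0* L0` by twice the real part of `Zsf W`. -/
theorem adjoint_comp_self_sub_comp
    {E F 𝒦 : Type*} [NormedAddCommGroup E] [InnerProductSpace ℂ E] [CompleteSpace E]
    [NormedAddCommGroup F] [InnerProductSpace ℂ F] [CompleteSpace F]
    [NormedAddCommGroup 𝒦] [InnerProductSpace ℂ 𝒦] [CompleteSpace 𝒦]
    {L0 : E →L[ℂ] 𝒦} {L1 : F →L[ℂ] 𝒦} {Zsf : F →L[ℂ] E} {Zfs W : E →L[ℂ] F}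
    {A : F →L[ℂ] F} (hW : A ∘L W = Zfs)
    (hAA : A + adjoint A = -(adjoint L1 ∘L L1))
    (hZZ : Zsf + adjoint Zfs = -(adjoint L0 ∘L L1)) :
    adjoint (L0 - L1 ∘L W) ∘L (L0 - L1 ∘L W)
      = adjoint L0 ∘L L0 + (Zsf ∘L W + adjoint (Zsf ∘L W)) := by
  have hcross : adjoint L0 ∘L L1 ∘L W = -(Zsf ∘L W + adjoint Zfs ∘L W) := by
    rw [← comp_assoc, ← add_comp, hZZ, neg_comp, neg_neg]
  have hcross_adj : adjoint W ∘L adjoint L1 ∘L L0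
      = -(adjoint W ∘L adjoint Zsf + adjoint W ∘L Zfs) := by
    simpa [adjoint_comp, comp_assoc] using congrArg adjoint hcross
  have hAW : adjoint W ∘L adjoint A = adjoint Zfs := by
    rw [← adjoint_comp, hW]
  have hquad : adjoint W ∘L adjoint L1 ∘L L1 ∘L W
      = -(adjoint W ∘L Zfs + adjoint Zfs ∘L W) := by
    rw [← comp_assoc (adjoint L1), ← neg_neg (adjoint L1 ∘L L1), ← hAA, neg_comp, comp_neg,
      add_comp, comp_add, hW, ← comp_assoc, hAW]
  simp only [map_sub, adjoint_comp, sub_comp, comp_sub, comp_assoc, hcross, hcross_adj, hquad]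
  abel

/-- **Schur complement form of the reduced generator.** For adiabatic
block data `(L⁰, L¹, Z_sf, Z_fs, A, H⁰)` with `A + A* = -(L¹)*L¹` and
`Z_sf + (Z_fs)* = -(L⁰)*L¹`, the reduced pair `L̂ = L⁰ - L¹ A⁻¹ Z_fs`,
`Ĥ = H⁰ + Im(Z_sf A⁻¹ Z_fs)` satisfies
`-(1/2)(L̂)*L̂ - iĤ = (-(1/2)(L⁰)*L⁰ - iH⁰) - Z_sf A⁻¹ Z_fs`. -/
theorem reduced_generator_schur_complement
    {E F 𝒦 : Type*} [NormedAddCommGroup E] [InnerProductSpace ℂ E] [CompleteSpace E]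
    [NormedAddCommGroup F] [InnerProductSpace ℂ F] [CompleteSpace F]
    [NormedAddCommGroup 𝒦] [InnerProductSpace ℂ 𝒦] [CompleteSpace 𝒦]
    (L0 : E →L[ℂ] 𝒦) (L1 : F →L[ℂ] 𝒦) (Zsf : F →L[ℂ] E) (Zfs : E →L[ℂ] F)
    (A : F →L[ℂ] F) (H0 : E →L[ℂ] E)
    (hA : IsUnit A) (hH0 : IsSelfAdjoint H0)
    (hAA : A + adjoint A = -(adjoint L1 ∘L L1))
    (hZZ : Zsf + adjoint Zfs = -(adjoint L0 ∘L L1))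
    (Lhat : E →L[ℂ] 𝒦) (hLhat : Lhat = L0 - L1 ∘L Ring.inverse A ∘L Zfs)
    (Hhat : E →L[ℂ] E)
    (hHhat : Hhat = H0 + (2 * Complex.I)⁻¹ •
        ((Zsf ∘L Ring.inverse A ∘L Zfs) - adjoint (Zsf ∘L Ring.inverse A ∘L Zfs))) :
    -((1/2 : ℂ) • (adjoint Lhat ∘L Lhat)) - Complex.I • Hhat
      = (-((1/2 : ℂ) • (adjoint L0 ∘L L0)) - Complex.I • H0)
          - Zsf ∘L Ring.inverse A ∘L Zfs := by
  have hW : A ∘L (Ring.inverse A ∘L Zfs) = Zfs := by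
    have h : A ∘L Ring.inverse A = .id ℂ F := Ring.mul_inverse_cancel A hA
    rw [← comp_assoc, h, id_comp]
  have hI : Complex.I * (2 * Complex.I)⁻¹ = 1 / 2 := by
    field_simp
  rw [hLhat, hHhat, adjoint_comp_self_sub_comp hW hAA hZZ, smul_add Complex.I, smul_smul, hI]
  module
end

section
/- Intertwining identity for the reduced coupling. Assume the adiabatic block data (L⁰, L¹, Z_sf, Z_fs, A, H⁰) on (E, F, 𝒦) with the structural identities A + A* = -(L¹)*L¹ and Z_sf + (Z_fs)* = -(L⁰)*L¹. Define L̂ := L⁰ - L¹∘A⁻¹∘Z_fs : E → 𝒦. Then (L̂)*∘(I + L¹∘A⁻¹∘(L¹)*) = (L⁰)* - Z_sf∘A⁻¹∘(L¹)* as bounded operators from 𝒦 to E. -/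
open ContinuousLinearMap

/-- **Intertwining identity for the reduced coupling.** For adiabatic
block data with `A + A* = -(L¹)*L¹` and `Z_sf + (Z_fs)* = -(L⁰)*L¹`, the reduced
coupling `L̂ = L⁰ - L¹ A⁻¹ Z_fs` satisfies
`(L̂)* (I + L¹ A⁻¹ (L¹)*) = (L⁰)* - Z_sf A⁻¹ (L¹)*`. -/
theorem reduced_coupling_intertwining
    {E F 𝒦 : Type*} [NormedAddCommGroup E] [InnerProductSpace ℂ E] [CompleteSpace E]
    [NormedAddCommGroup F] [InnerProductSpace ℂ F] [CompleteSpace F]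
    [NormedAddCommGroup 𝒦] [InnerProductSpace ℂ 𝒦] [CompleteSpace 𝒦]
    (L0 : E →L[ℂ] 𝒦) (L1 : F →L[ℂ] 𝒦) (Zsf : F →L[ℂ] E) (Zfs : E →L[ℂ] F)
    (A : F →L[ℂ] F) (H0 : E →L[ℂ] E)
    (hA : IsUnit A) (hH0 : IsSelfAdjoint H0)
    (hAA : A + adjoint A = -(adjoint L1 ∘L L1))
    (hZZ : Zsf + adjoint Zfs = -(adjoint L0 ∘L L1))
    (Lhat : E →L[ℂ] 𝒦) (hLhat : Lhat = L0 - L1 ∘L Ring.inverse A ∘L Zfs) :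
    adjoint Lhat ∘L ((1 : 𝒦 →L[ℂ] 𝒦) + L1 ∘L Ring.inverse A ∘L adjoint L1)
      = adjoint L0 - Zsf ∘L Ring.inverse A ∘L adjoint L1 := by
  have hAB : A ∘L Ring.inverse A = 1 := Ring.mul_inverse_cancel A hA
  have hBA : adjoint (Ring.inverse A) ∘L adjoint A = 1 := by
    rw [← adjoint_comp, hAB, ← star_eq_adjoint, star_one]
  ext x
  set w : F := Ring.inverse A (adjoint L1 x) with hw
  have hAw : A w = adjoint L1 x := DFunLike.congr_fun hAB (adjoint L1 x)
  have hBAw : adjoint (Ring.inverse A) (adjoint A w) = w := DFunLike.congr_fun hBA w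
  have hL1w : adjoint L1 x + adjoint L1 (L1 w) = -adjoint A w := by
    have h : A w + adjoint A w = -adjoint L1 (L1 w) := DFunLike.congr_fun hAA w
    rw [← hAw, eq_neg_iff_add_eq_zero, add_right_comm, h, neg_add_cancel]
  have hL0w : Zsf w + adjoint Zfs w = -adjoint L0 (L1 w) := DFunLike.congr_fun hZZ w
  calc (adjoint Lhat ∘L (1 + L1 ∘L Ring.inverse A ∘L adjoint L1)) x
      = adjoint L0 x + adjoint L0 (L1 w)
        - adjoint Zfs (adjoint (Ring.inverse A) (adjoint L1 x + adjoint L1 (L1 w))) := by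
        simp only [hLhat, map_sub, adjoint_comp, comp_apply, sub_apply, add_apply,
          one_apply_eq_self, map_add, ← hw]
        abel
    _ = adjoint L0 x + adjoint L0 (L1 w) + adjoint Zfs w := by
        rw [hL1w, map_neg, map_neg, hBAw, sub_neg_eq_add]
    _ = adjoint L0 x - Zsf w := by
        rw [← neg_eq_iff_eq_neg.mpr hL0w]
        abel
end
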